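/- arXiv:1910.03547 — 8 statements merged into one kernel-verified Lean document; each statement's English description precedes it below -/
import Mathlib

section
/- Let n ≥ 1 be a natural number and let 0 < r1 < r0 be real numbers. There exists a constant c > 0 (depending on n, r1, r0) such that for every continuously differentiable function f : ℝⁿ → ℝ satisfying f(x) = 0 for all x with ‖x‖ = r1, one has ∫_{A(r1,r0)} f(x)² dx ≤ c ∫_{A(r1,r0)} ‖∇f(x)‖² dx. -/
open MeasureTheory
open Set

lemma polar_aux {E : Type*} [NormedAddCommGroup E] [NormedSpace ℝ E] [FiniteDimensional ℝ E]
    [MeasurableSpace E] [BorelSpace E] [Nontrivial E] (μ : Measure E) [μ.IsAddHaarMeasure]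
    (g : E → ENNReal) (hg : Measurable g) :
    ∫⁻ x, g x ∂μ = ∫⁻ w, (∫⁻ r in Ioi (0:ℝ),
      ENNReal.ofReal (r ^ (Module.finrank ℝ E - 1)) * g (r • (w : E))) ∂μ.toSphere := by
  have hmp := μ.measurePreserving_homeomorphUnitSphereProd
  have h1 : ∫⁻ x, g x ∂μ = ∫⁻ x : ({(0:E)}ᶜ : Set E), g x ∂(μ.comap (↑)) := by
    rw [lintegral_subtype_comap (measurableSet_singleton _).compl, restrict_compl_singleton]
  have hm : Measurable fun p : Metric.sphere (0:E) 1 × Ioi (0:ℝ) => g (p.2.1 • p.1.1) := by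
    apply hg.comp
    fun_prop
  have h2 : ∫⁻ x : ({(0:E)}ᶜ : Set E), g x ∂(μ.comap (↑)) =
      ∫⁻ p, g (p.2.1 • p.1.1) ∂(μ.toSphere.prod (Measure.volumeIoiPow (Module.finrank ℝ E - 1))) := by
    rw [← hmp.lintegral_comp hm]
    refine lintegral_congr fun x => ?_
    congr 1
    have hx : ‖(x : E)‖ ≠ 0 := norm_ne_zero_iff.2 x.2
    simp [smul_smul, hx]
  rw [h1, h2, lintegral_prod _ hm.aemeasurable]
  refine lintegral_congr fun w => ?_
  have hm2 : Measurable fun r : Ioi (0:ℝ) => g (r.1 • w.1) := by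
    apply hg.comp
    fun_prop
  rw [Measure.volumeIoiPow, lintegral_withDensity_eq_lintegral_mul _ (by fun_prop) hm2,
    ← lintegral_subtype_comap measurableSet_Ioi]
  rfl

lemma cs_aux (a b : ℝ) (hab : a < b) (G : ℝ → ℝ) (hG : Continuous G) :
    (∫ s in a..b, G s) ^ 2 ≤ (b - a) * ∫ s in a..b, G s ^ 2 := by
  set I := ∫ s in a..b, G s with hI
  have hL : 0 < b - a := sub_pos.2 hab
  set m := I / (b - a) with hm
  have h0 : 0 ≤ ∫ s in a..b, (G s - m) ^ 2 :=
    intervalIntegral.integral_nonneg hab.le fun _ _ => sq_nonneg _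
  have h1 : ∫ s in a..b, (G s - m) ^ 2 = (∫ s in a..b, G s ^ 2) - 2 * m * I + m ^ 2 * (b - a) := by
    have : ∀ s, (G s - m) ^ 2 = G s ^ 2 - 2 * m * G s + m ^ 2 := fun s => by ring
    simp_rw [this]
    rw [intervalIntegral.integral_add, intervalIntegral.integral_sub,
      intervalIntegral.integral_const_mul, intervalIntegral.integral_const, smul_eq_mul]
    · ring
    all_goals apply Continuous.intervalIntegrable; fun_prop
  have hI2 : I = m * (b - a) := by rw [hm]; field_simp
  rw [h1] at h0
  rw [hI2] at h0 ⊢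
  nlinarith

lemma radial_aux (a b : ℝ) (hab : a < b) (F G : ℝ → ℝ) (hF : ContDiff ℝ 1 F) (hG : Continuous G)
    (hFG : ∀ s, |deriv F s| ≤ G s) (hFa : F a = 0) (r : ℝ) (hr : r ∈ Ioo a b) :
    F r ^ 2 ≤ (b - a) * ∫ s in a..b, G s ^ 2 := by
  have hd : Continuous (deriv F) := hF.continuous_deriv le_rfl
  have h1 : ∫ s in a..r, deriv F s = F r - F a :=
    intervalIntegral.integral_deriv_eq_sub
      (fun x _ => (hF.differentiable one_ne_zero).differentiableAt) (hd.intervalIntegrable _ _)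
  rw [hFa, sub_zero] at h1
  have hG0 : ∀ s, 0 ≤ G s := fun s => (abs_nonneg _).trans (hFG s)
  have h2 : |F r| ≤ ∫ s in a..r, G s := by
    rw [← h1, ← Real.norm_eq_abs]
    exact intervalIntegral.norm_integral_le_of_norm_le hr.1.le
      (Filter.Eventually.of_forall fun s _ => hFG s) (hG.intervalIntegrable _ _)
  have h3 : ∫ s in a..r, G s ≤ ∫ s in a..b, G s :=
    intervalIntegral.integral_mono_interval le_rfl hr.1.le hr.2.le
      (Filter.Eventually.of_forall hG0) (hG.intervalIntegrable _ _)
  calc F r ^ 2 = |F r| ^ 2 := (sq_abs _).symm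
    _ ≤ (∫ s in a..b, G s) ^ 2 := by gcongr; exact h2.trans h3
    _ ≤ _ := cs_aux a b hab G hG

lemma radial_lint (a b : ℝ) (ha : 0 < a) (hab : a < b) (k : ℕ) (F G : ℝ → ℝ) (hF : ContDiff ℝ 1 F)
    (hG : Continuous G)
    (hFG : ∀ s, |deriv F s| ≤ G s) (hFa : F a = 0) :
    ∫⁻ r in Ioo a b, ENNReal.ofReal (r ^ k) * ENNReal.ofReal (F r ^ 2) ≤
     ENNReal.ofReal ((b / a) ^ k * (b - a) ^ 2) *
       ∫⁻ r in Ioo a b, ENNReal.ofReal (r ^ k) * ENNReal.ofReal (G r ^ 2) := by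
  have hL : 0 < b - a := sub_pos.2 hab
  have hb : 0 < b := ha.trans hab
  have e : ENNReal.ofReal (∫ s in a..b, G s ^ 2) = ∫⁻ s in Ioo a b, ENNReal.ofReal (G s ^ 2) := by
    rw [intervalIntegral.integral_of_le hab.le, integral_Ioc_eq_integral_Ioo,
      ofReal_integral_eq_lintegral_ofReal]
    · exact ((hG.pow 2).integrableOn_Icc).mono_set Ioo_subset_Icc_self
    · exact Filter.Eventually.of_forall fun _ => sq_nonneg _
  calc ∫⁻ r in Ioo a b, ENNReal.ofReal (r ^ k) * ENNReal.ofReal (F r ^ 2)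
      ≤ ∫⁻ r in Ioo a b, ENNReal.ofReal (b ^ k * ((b - a) * ∫ s in a..b, G s ^ 2)) := by
        refine setLIntegral_mono' measurableSet_Ioo fun r hr => ?_
        have : 0 < r := ha.trans hr.1
        rw [← ENNReal.ofReal_mul (by positivity)]
        apply ENNReal.ofReal_le_ofReal
        have := radial_aux a b hab F G hF hG hFG hFa r hr
        have := hr.2.le
        gcongr
    _ = ENNReal.ofReal ((b / a) ^ k * (b - a) ^ 2) *
        (ENNReal.ofReal (a ^ k) * ∫⁻ s in Ioo a b, ENNReal.ofReal (G s ^ 2)) := by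
        rw [setLIntegral_const, Real.volume_Ioo, ← e]
        have h0 : 0 ≤ ∫ s in a..b, G s ^ 2 := 
          intervalIntegral.integral_nonneg hab.le fun _ _ => sq_nonneg _
        rw [← ENNReal.ofReal_mul (by positivity), ← ENNReal.ofReal_mul (by positivity),
          ← ENNReal.ofReal_mul (by positivity)]
        congr 1
        rw [div_pow]
        field_simp
    _ ≤ _ := by
        gcongr
        rw [← lintegral_const_mul' _ _ ENNReal.ofReal_ne_top]
        refine setLIntegral_mono' measurableSet_Ioo fun r hr => ?_
        have := hr.1.le
        gcongr

theorem annulus_poincare (n : ℕ) (hn : 1 ≤ n) (r1 r0 : ℝ) (hr1 : 0 < r1) (hr : r1 < r0) :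
    ∃ c : ℝ, 0 < c ∧ ∀ f : EuclideanSpace ℝ (Fin n) → ℝ, ContDiff ℝ 1 f →
      (∀ x : EuclideanSpace ℝ (Fin n), ‖x‖ = r1 → f x = 0) →
      ∫ x in {x : EuclideanSpace ℝ (Fin n) | r1 < ‖x‖ ∧ ‖x‖ < r0}, (f x) ^ 2
        ≤ c * ∫ x in {x : EuclideanSpace ℝ (Fin n) | r1 < ‖x‖ ∧ ‖x‖ < r0},
            ‖fderiv ℝ f x‖ ^ 2 := by
  have hL : 0 < r0 - r1 := sub_pos.2 hr
  have hr0 : 0 < r0 := hr1.trans hr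
  have hc : 0 < (r0 / r1) ^ (n - 1) * (r0 - r1) ^ 2 := by positivity
  refine ⟨(r0 / r1) ^ (n - 1) * (r0 - r1) ^ 2, hc, fun f hf hf0 => ?_⟩
  haveI : Nonempty (Fin n) := ⟨⟨0, hn⟩⟩
  set A := {x : EuclideanSpace ℝ (Fin n) | r1 < ‖x‖ ∧ ‖x‖ < r0} with hA
  have hAm : MeasurableSet A :=
    ((isOpen_lt continuous_const continuous_norm).inter
      (isOpen_lt continuous_norm continuous_const)).measurableSet
  have hfd : Continuous (fderiv ℝ f) := hf.continuous_fderiv one_ne_zero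
  have polarA : ∀ u : EuclideanSpace ℝ (Fin n) → ℝ, Continuous u →
      ∫⁻ x in A, ENNReal.ofReal (u x ^ 2) = 
      ∫⁻ w, (∫⁻ r in Ioo r1 r0, ENNReal.ofReal (r ^ (n - 1)) *
        ENNReal.ofReal (u (r • (w : EuclideanSpace ℝ (Fin n))) ^ 2))
        ∂(volume : Measure (EuclideanSpace ℝ (Fin n))).toSphere := by
    intro u hu
    rw [← lintegral_indicator hAm, polar_aux _ _ (Measurable.indicator (by fun_prop) hAm)]
    refine lintegral_congr fun w => ?_
    rw [finrank_euclideanSpace_fin, ← lintegral_indicator measurableSet_Ioi,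
      ← lintegral_indicator measurableSet_Ioo]
    refine lintegral_congr fun r => ?_
    have hw : ‖(w : EuclideanSpace ℝ (Fin n))‖ = 1 := by simpa using w.2
    by_cases h0 : 0 < r
    · have hiff : r • (w : EuclideanSpace ℝ (Fin n)) ∈ A ↔ r ∈ Ioo r1 r0 := by
        simp [hA, norm_smul, hw, abs_of_pos h0]
      by_cases h : r ∈ Ioo r1 r0
      · rw [indicator_of_mem (mem_Ioi.2 h0), indicator_of_mem (hiff.2 h), indicator_of_mem h]
      · rw [indicator_of_mem (mem_Ioi.2 h0), indicator_of_notMem (mt hiff.1 h),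
          indicator_of_notMem h, mul_zero]
    · rw [indicator_of_notMem (by simpa using h0), indicator_of_notMem]
      exact fun h => h0 (hr1.trans h.1)
  have key : ∫⁻ x in A, ENNReal.ofReal (f x ^ 2) ≤
      ENNReal.ofReal ((r0 / r1) ^ (n - 1) * (r0 - r1) ^ 2) *
        ∫⁻ x in A, ENNReal.ofReal (‖fderiv ℝ f x‖ ^ 2) := by
    rw [polarA f hf.continuous, polarA (fun x => ‖fderiv ℝ f x‖) hfd.norm,
      ← lintegral_const_mul' _ _ ENNReal.ofReal_ne_top]
    refine lintegral_mono fun w => ?_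
    have hw : ‖(w : EuclideanSpace ℝ (Fin n))‖ = 1 := by simpa using w.2
    refine radial_lint r1 r0 hr1 hr (n - 1) (fun r => f (r • (w : EuclideanSpace ℝ (Fin n))))
      (fun r => ‖fderiv ℝ f (r • (w : EuclideanSpace ℝ (Fin n)))‖) 
      (hf.comp (by fun_prop)) (hfd.norm.comp (by fun_prop)) (fun s => ?_) ?_
    · have h1 : HasDerivAt (fun r : ℝ => r • (w : EuclideanSpace ℝ (Fin n))) w.1 s := by
        simpa using (hasDerivAt_id s).smul_const w.1
      have h2 := ((hf.differentiable one_ne_zero) (s • w.1)).hasFDerivAt.comp_hasDerivAt s h1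
      have h3 := h2.deriv
      simp only [Function.comp_def] at h3
      rw [h3, ← Real.norm_eq_abs]
      simpa [hw] using (fderiv ℝ f (s • w.1)).le_opNorm w.1
    · apply hf0
      simp [norm_smul, hw, abs_of_pos hr1]
  have hint : ∀ u : EuclideanSpace ℝ (Fin n) → ℝ, Continuous u →
      IntegrableOn (fun x => u x ^ 2) A := by
    intro u hu
    refine ((hu.pow 2).continuousOn.integrableOn_compact
      (isCompact_closedBall (0 : EuclideanSpace ℝ (Fin n)) r0)).mono_set ?_
    intro x hx
    simpa using hx.2.le
  have hnn : 0 ≤ ∫ x in A, ‖fderiv ℝ f x‖ ^ 2 := integral_nonneg fun _ => sq_nonneg _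
  rw [← ENNReal.ofReal_le_ofReal_iff (by positivity), ENNReal.ofReal_mul hc.le,
    ofReal_integral_eq_lintegral_ofReal (hint f hf.continuous)
      (Filter.Eventually.of_forall fun _ => sq_nonneg _),
    ofReal_integral_eq_lintegral_ofReal (hint _ hfd.norm)
      (Filter.Eventually.of_forall fun _ => sq_nonneg _)]
  exact key
end

section
/- Let n ≥ 1 be a natural number and let 0 < r1 < r0 be real numbers. Write points of ℝⁿ⁺¹ as pairs (y, s) with y ∈ ℝⁿ and s ∈ ℝ, and let A⁺ = {(y,s) ∈ ℝⁿ⁺¹ : r1 < ‖(y,s)‖ < r0, s > 0} be the open upper half-annulus. There exists a constant c > 0 (depending on n, r1, r0) such that for every continuously differentiable function f : ℝⁿ⁺¹ → ℝ satisfying f(x) = 0 for all x = (y,s) with ‖x‖ = r1 and s ≥ 0, one has ∫_{{y ∈ ℝⁿ : r1 < ‖y‖ < r0}} f(y,0)² dy + ∫_{A⁺} f(x)² dx ≤ c ∫_{A⁺} ‖∇f(x)‖² dx. -/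
open MeasureTheory

/-- The inclusion `y ↦ (y, s)` of `ℝⁿ × ℝ` into `ℝⁿ⁺¹`. -/
noncomputable def withLast (n : ℕ) (y : EuclideanSpace ℝ (Fin n)) (s : ℝ) :
    EuclideanSpace ℝ (Fin (n + 1)) := WithLp.toLp 2 (Fin.snoc (α := fun _ => ℝ) (WithLp.ofLp y) s)

open Set

lemma line_bound {E : Type*} [NormedAddCommGroup E] [NormedSpace ℝ E] {f : E → ℝ}
    (hf : ContDiff ℝ 1 f) (x v : E) (T : ℝ) (hT0 : 0 ≤ T) (hT1 : T ≤ 1)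
    (h : f (x + T • v) = 0) :
    ENNReal.ofReal (f x ^ 2) ≤ ENNReal.ofReal (‖v‖ ^ 2) *
      ∫⁻ t in Ioo 0 T, ENNReal.ofReal (‖fderiv ℝ f (x + t • v)‖ ^ 2) := by
  have hc : Continuous (fun t : ℝ => fderiv ℝ f (x + t • v)) :=
    (hf.continuous_fderiv one_ne_zero).comp (by fun_prop)
  have hcv : Continuous (fun t : ℝ => fderiv ℝ f (x + t • v) v) := hc.clm_apply continuous_const
  have hd : ∀ t : ℝ, HasDerivAt (fun t : ℝ => f (x + t • v)) (fderiv ℝ f (x + t • v) v) t := by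
    intro t
    have h1 : HasFDerivAt f (fderiv ℝ f (x + t • v)) (x + t • v) :=
      (hf.differentiable one_ne_zero _).hasFDerivAt
    have h2 : HasDerivAt (fun t : ℝ => x + t • v) v t := by
      simpa using ((hasDerivAt_id t).smul_const v).const_add x
    exact h1.comp_hasDerivAt t h2
  set I := ∫ t in (0:ℝ)..T, fderiv ℝ f (x + t • v) v with hI
  have e1 : I = - f x := by
    rw [hI, intervalIntegral.integral_eq_sub_of_hasDerivAt (fun t _ => hd t)
      (hcv.intervalIntegrable _ _), h]
    simp
  have e2 : I ^ 2 ≤ ∫ t in (0:ℝ)..T, (fderiv ℝ f (x + t • v) v) ^ 2 := by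
    have p : 0 ≤ ∫ t in (0:ℝ)..T, ((fderiv ℝ f (x + t • v) v) - I) ^ 2 :=
      intervalIntegral.integral_nonneg hT0 (fun t _ => sq_nonneg _)
    have q : ∫ t in (0:ℝ)..T, ((fderiv ℝ f (x + t • v) v) - I) ^ 2
        = (∫ t in (0:ℝ)..T, (fderiv ℝ f (x + t • v) v) ^ 2) - (2 * I) * I + T * I ^ 2 := by
      have : ∀ t : ℝ, ((fderiv ℝ f (x + t • v) v) - I) ^ 2
        = (fderiv ℝ f (x + t • v) v) ^ 2 - (2 * I) * (fderiv ℝ f (x + t • v) v) + I ^ 2 := by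
        intro t; ring
      simp_rw [this]
      rw [intervalIntegral.integral_add, intervalIntegral.integral_sub,
        intervalIntegral.integral_const_mul, ← hI]
      · simp
      all_goals
        apply Continuous.intervalIntegrable
        fun_prop
    nlinarith [sq_nonneg I]
  have e3 : ∫ t in (0:ℝ)..T, (fderiv ℝ f (x + t • v) v) ^ 2 ≤
      ∫ t in (0:ℝ)..T, ‖v‖ ^ 2 * ‖fderiv ℝ f (x + t • v)‖ ^ 2 := by
    apply intervalIntegral.integral_mono_on hT0
    · apply Continuous.intervalIntegrable; fun_prop
    · apply Continuous.intervalIntegrable; fun_prop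
    · intro t _
      have := (fderiv ℝ f (x + t • v)).le_opNorm v
      rw [← mul_pow, mul_comm, ← sq_abs]
      gcongr
      exact this
  have hcn : Continuous (fun t : ℝ => ‖fderiv ℝ f (x + t • v)‖ ^ 2) := by fun_prop
  rw [← ofReal_integral_eq_lintegral_ofReal
    ((hcn.integrableOn_Icc (a := 0) (b := T)).mono_set Ioo_subset_Icc_self)
    (Filter.Eventually.of_forall fun t => by positivity), ← ENNReal.ofReal_mul (by positivity)]
  apply ENNReal.ofReal_le_ofReal
  have e4 := e2.trans e3
  rw [intervalIntegral.integral_const_mul, intervalIntegral.integral_of_le hT0 (μ := volume),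
    integral_Ioc_eq_integral_Ioo] at e4
  calc f x ^ 2 = I ^ 2 := by rw [e1]; ring
    _ ≤ _ := e4

lemma scale_bound {E : Type*} [NormedAddCommGroup E] [InnerProductSpace ℝ E]
    [FiniteDimensional ℝ E] [MeasurableSpace E] [BorelSpace E] {G : E → ENNReal}
    (hG : Measurable G) {d r : ℝ} (hd : 0 < d) (hr : d ≤ r) :
    ∫⁻ x, G (r • x) ≤ ENNReal.ofReal ((d ^ Module.finrank ℝ E)⁻¹) * ∫⁻ x, G x := by
  have hr0 : 0 < r := hd.trans_le hr
  rw [← lintegral_map (f := G) (g := fun x : E => r • x) hG (by fun_prop),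
    Measure.map_addHaar_smul _ hr0.ne', lintegral_smul_measure, smul_eq_mul]
  gcongr
  rw [abs_of_nonneg (by positivity)]
  gcongr

lemma withLast_castSucc (n : ℕ) (y : EuclideanSpace ℝ (Fin n)) (s : ℝ) (i : Fin n) :
    withLast n y s i.castSucc = y i := by
  simp [withLast]

lemma withLast_last (n : ℕ) (y : EuclideanSpace ℝ (Fin n)) (s : ℝ) :
    withLast n y s (Fin.last n) = s := by
  simp [withLast]

lemma withLast_norm_sq (n : ℕ) (y : EuclideanSpace ℝ (Fin n)) (s : ℝ) :
    ‖withLast n y s‖ ^ 2 = ‖y‖ ^ 2 + s ^ 2 := by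
  simp [EuclideanSpace.norm_sq_eq, Fin.sum_univ_castSucc, withLast_castSucc, withLast_last]

lemma withLast_line (n : ℕ) (y : EuclideanSpace ℝ (Fin n)) (r t : ℝ) :
    withLast n y 0 + t • withLast n (-y) r = withLast n ((1 - t) • y) (t * r) := by
  ext i
  refine Fin.lastCases ?_ (fun i => ?_) i
  · simp [withLast_last]
  · simp [withLast_castSucc]; ring

lemma withLast_continuous (n : ℕ) :
    Continuous (fun p : ℝ × EuclideanSpace ℝ (Fin n) => withLast n p.2 p.1) := by
  refine (PiLp.continuous_toLp 2 _).comp (continuous_pi fun i => ?_)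
  refine Fin.lastCases ?_ (fun i => ?_) i
  · simp; fun_prop
  · simp; fun_prop

lemma withLast_mp (n : ℕ) :
    MeasurePreserving (fun p : ℝ × EuclideanSpace ℝ (Fin n) => withLast n p.2 p.1) := by
  have h1 := (volume_preserving_piFinSuccAbove (fun _ : Fin (n + 1) => ℝ) (Fin.last n)).symm
  have h2 := (MeasurePreserving.id (volume : Measure ℝ)).prod (PiLp.volume_preserving_ofLp (Fin n))
  have h3 := (PiLp.volume_preserving_toLp (Fin (n+1))).comp (h1.comp h2)
  rw [← Measure.volume_eq_prod] at h3
  convert h3 using 1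
  ext p i
  simp [withLast, MeasurableEquiv.piFinSuccAbove, Fin.insertNthEquiv, Fin.insertNth_last']

lemma withLast_lintegral (n : ℕ) {G : EuclideanSpace ℝ (Fin (n + 1)) → ENNReal}
    (hG : Measurable G) : ∫⁻ s, ∫⁻ y, G (withLast n y s) = ∫⁻ x, G x := by
  rw [← (withLast_mp n).lintegral_comp hG, Measure.volume_eq_prod,
    lintegral_prod (fun p => G (withLast n p.2 p.1))
      (hG.comp (withLast_mp n).measurable).aemeasurable]

lemma part_two (n : ℕ) {G : EuclideanSpace ℝ (Fin (n + 1)) → ENNReal}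
    (hG : Measurable G) {d r : ℝ} (hd : 0 < d) (hr : 0 < r) :
    ∫⁻ y, ∫⁻ t in Ioo 0 (1 - d), G (withLast n ((1 - t) • y) (t * r)) ≤
      ENNReal.ofReal ((d ^ n)⁻¹) * (ENNReal.ofReal r⁻¹ * ∫⁻ x, G x) := by
  rw [lintegral_lintegral_swap]
  swap
  · refine (hG.comp ((withLast_continuous n).comp
      (f := fun p : EuclideanSpace ℝ (Fin n) × ℝ => (p.2 * r, (1 - p.2) • p.1))
      (by fun_prop)).measurable).aemeasurable
  have hm : Measurable (fun s : ℝ => ∫⁻ y, G (withLast n y s)) :=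
    (hG.comp (withLast_continuous n).measurable).lintegral_prod_right'
  calc _ ≤ ∫⁻ t in Ioo 0 (1 - d), ENNReal.ofReal ((d ^ n)⁻¹) * ∫⁻ y, G (withLast n y (t * r)) := by
        refine setLIntegral_mono' measurableSet_Ioo fun t ht => ?_
        have := scale_bound (E := EuclideanSpace ℝ (Fin n)) (G := fun y => G (withLast n y (t * r)))
          (hG.comp ((withLast_continuous n).comp (f := fun y => (t * r, y))
            (by fun_prop)).measurable) hd (r := 1 - t) (by linarith [ht.2])
        simpa using this
    _ ≤ ∫⁻ t, ENNReal.ofReal ((d ^ n)⁻¹) * ∫⁻ y, G (withLast n y (t * r)) :=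
        setLIntegral_le_lintegral _ _
    _ = ENNReal.ofReal ((d ^ n)⁻¹) * ∫⁻ t, ∫⁻ y, G (withLast n y (t * r)) :=
        lintegral_const_mul _ (hm.comp (by fun_prop))
    _ ≤ _ := by
        gcongr
        have := scale_bound hm hr le_rfl
        rw [withLast_lintegral n hG] at this
        simpa [mul_comm] using this

lemma part_one (n : ℕ) {G : EuclideanSpace ℝ (Fin (n + 1)) → ENNReal}
    (hG : Measurable G) {d : ℝ} (hd : 0 < d) :
    ∫⁻ x, ∫⁻ t in Ioo 0 (1 - d), G ((1 - t) • x) ≤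
      ENNReal.ofReal ((d ^ (n + 1))⁻¹) * ∫⁻ x, G x := by
  rw [lintegral_lintegral_swap]
  swap
  · exact (hG.comp (Continuous.measurable (by fun_prop : Continuous
      (fun p : EuclideanSpace ℝ (Fin (n + 1)) × ℝ => (1 - p.2) • p.1)))).aemeasurable
  calc _ ≤ ∫⁻ t in Ioo 0 (1 - d), ENNReal.ofReal ((d ^ (n + 1))⁻¹) * ∫⁻ y, G y := by
        refine setLIntegral_mono' measurableSet_Ioo fun t ht => ?_
        have := scale_bound hG hd (r := 1 - t) (by linarith [ht.2])
        simpa using this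
    _ ≤ _ := by
        rw [setLIntegral_const, Real.volume_Ioo]
        refine mul_le_of_le_one_right' ?_
        rw [← ENNReal.ofReal_one]
        exact ENNReal.ofReal_le_ofReal (by linarith)

theorem half_annulus_poincare (n : ℕ) (hn : 1 ≤ n) (r1 r0 : ℝ) (hr1 : 0 < r1) (hr : r1 < r0) :
    ∃ c : ℝ, 0 < c ∧ ∀ f : EuclideanSpace ℝ (Fin (n + 1)) → ℝ, ContDiff ℝ 1 f →
      (∀ x : EuclideanSpace ℝ (Fin (n + 1)), ‖x‖ = r1 → 0 ≤ x (Fin.last n) → f x = 0) →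
      (∫ y in {y : EuclideanSpace ℝ (Fin n) | r1 < ‖y‖ ∧ ‖y‖ < r0}, (f (withLast n y 0)) ^ 2)
        + (∫ x in {x : EuclideanSpace ℝ (Fin (n + 1)) |
              (r1 < ‖x‖ ∧ ‖x‖ < r0) ∧ 0 < x (Fin.last n)}, (f x) ^ 2)
        ≤ c * ∫ x in {x : EuclideanSpace ℝ (Fin (n + 1)) |
              (r1 < ‖x‖ ∧ ‖x‖ < r0) ∧ 0 < x (Fin.last n)}, ‖fderiv ℝ f x‖ ^ 2 := by
  have hr0 : 0 < r0 := hr1.trans hr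
  set d : ℝ := r1 ^ 2 / r0 ^ 2 with hd_def
  have hd : 0 < d := by positivity
  have hd1 : d ≤ 1 := by
    rw [hd_def, div_le_one (by positivity)]; gcongr
  refine ⟨2 * r0 ^ 2 * ((d ^ n)⁻¹ * r1⁻¹) + r0 ^ 2 * (d ^ (n + 1))⁻¹, by positivity, ?_⟩
  intro f hf hf0
  set A : Set (EuclideanSpace ℝ (Fin (n + 1))) :=
    {x | (r1 < ‖x‖ ∧ ‖x‖ < r0) ∧ 0 < x (Fin.last n)} with hA_def
  set B : Set (EuclideanSpace ℝ (Fin n)) := {y | r1 < ‖y‖ ∧ ‖y‖ < r0} with hB_def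
  have hA : MeasurableSet A := by
    apply IsOpen.measurableSet
    exact ((isOpen_lt (by fun_prop) (by fun_prop)).and
      (isOpen_lt (by fun_prop) (by fun_prop))).and (isOpen_lt (by fun_prop) (by fun_prop))
  have hB : MeasurableSet B := by
    apply IsOpen.measurableSet
    exact (isOpen_lt (by fun_prop) (by fun_prop)).and (isOpen_lt (by fun_prop) (by fun_prop))
  have iA : ∀ g : EuclideanSpace ℝ (Fin (n + 1)) → ℝ, Continuous g → IntegrableOn g A := by
    intro g hg
    refine (hg.continuousOn.integrableOn_compact (isCompact_closedBall 0 r0)).mono_set ?_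
    intro x hx
    simpa using hx.1.2.le
  have iB : ∀ g : EuclideanSpace ℝ (Fin n) → ℝ, Continuous g → IntegrableOn g B := by
    intro g hg
    refine (hg.continuousOn.integrableOn_compact (isCompact_closedBall 0 r0)).mono_set ?_
    intro x hx
    simpa using hx.2.le
  have hfc : Continuous f := hf.continuous
  have hDc : Continuous (fun x => ‖fderiv ℝ f x‖ ^ 2) :=
    (hf.continuous_fderiv one_ne_zero).norm.pow 2
  have hwc : Continuous (fun y => withLast n y 0) :=
    (withLast_continuous n).comp (f := fun y => ((0 : ℝ), y)) (by fun_prop)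
  set G : EuclideanSpace ℝ (Fin (n + 1)) → ENNReal :=
    A.indicator (fun x => ENNReal.ofReal (‖fderiv ℝ f x‖ ^ 2)) with hG_def
  have hG : Measurable G := by
    refine Measurable.indicator ?_ hA
    exact (ENNReal.continuous_ofReal.comp hDc).measurable
  set K := ∫ x in A, ‖fderiv ℝ f x‖ ^ 2 with hK_def
  have hK0 : 0 ≤ K := integral_nonneg fun x => by positivity
  have hGK : ∫⁻ x, G x = ENNReal.ofReal K := by
    rw [hG_def, lintegral_indicator hA, hK_def, ofReal_integral_eq_lintegral_ofReal (iA _ hDc)]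
    exact Filter.Eventually.of_forall fun t => by positivity
  -- general step
  have key : ∀ x v : EuclideanSpace ℝ (Fin (n + 1)), ∀ T M : ℝ, 0 ≤ T → T ≤ 1 - d →
      f (x + T • v) = 0 → ‖v‖ ^ 2 ≤ M → (∀ t ∈ Ioo 0 T, x + t • v ∈ A) →
      ENNReal.ofReal (f x ^ 2) ≤ ENNReal.ofReal M * ∫⁻ t in Ioo 0 (1 - d), G (x + t • v) := by
    intro x v T M hT0 hT h0 hM hin
    refine (line_bound hf x v T hT0 (by linarith) h0).trans ?_
    refine mul_le_mul' (ENNReal.ofReal_le_ofReal hM) ?_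
    calc _ = ∫⁻ t in Ioo 0 T, G (x + t • v) := by
          refine setLIntegral_congr_fun measurableSet_Ioo fun t ht => ?_
          simp [hG_def, indicator_of_mem (hin t ht)]
      _ ≤ _ := lintegral_mono_set (Ioo_subset_Ioo_right hT)
  have P1 : ∫ x in A, f x ^ 2 ≤ r0 ^ 2 * (d ^ (n + 1))⁻¹ * K := by
    rw [← ENNReal.ofReal_le_ofReal_iff (by positivity),
      ofReal_integral_eq_lintegral_ofReal (iA (fun x => f x ^ 2) (hfc.pow 2))
      (Filter.Eventually.of_forall fun t => sq_nonneg _), mul_assoc,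
      ENNReal.ofReal_mul (by positivity), ENNReal.ofReal_mul (by positivity), ← hGK]
    calc _ ≤ ∫⁻ x in A, ENNReal.ofReal (r0 ^ 2) * ∫⁻ t in Ioo 0 (1 - d), G ((1 - t) • x) := by
          refine setLIntegral_mono' hA fun x hx => ?_
          obtain ⟨⟨hx1, hx2⟩, hx3⟩ := hx
          have hx0 : 0 < ‖x‖ := hr1.trans hx1
          have e : ∀ t : ℝ, x + t • (-x) = (1 - t) • x := by intro t; module
          have hT1 : r1 / ‖x‖ ≤ 1 := by rw [div_le_one hx0]; exact hx1.le
          have := key x (-x) (1 - r1 / ‖x‖) (r0 ^ 2) (by linarith) ?_ ?_ ?_ ?_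
          · simpa only [e] using this
          · have : d ≤ r1 / ‖x‖ := by
              rw [hd_def, div_le_div_iff₀ (by positivity) hx0]
              nlinarith [mul_pos hr1 hr0, mul_pos hr1 hr1]
            linarith
          · rw [e]
            apply hf0
            · rw [norm_smul, Real.norm_of_nonneg (by simp; positivity)]
              field_simp
              ring
            · simp
              positivity
          · rw [norm_neg]; gcongr
          · intro t ht
            rw [e]
            have h1 : r1 / ‖x‖ < 1 - t := by linarith [ht.2]
            have h2 : 0 < 1 - t := lt_trans (by positivity) h1
            rw [div_lt_iff₀ hx0] at h1
            refine ⟨?_, ?_⟩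
            · rw [norm_smul, Real.norm_of_nonneg h2.le]
              exact ⟨h1, by nlinarith [ht.1]⟩
            · simp only [PiLp.smul_apply, smul_eq_mul]
              positivity
      _ ≤ ∫⁻ x, ENNReal.ofReal (r0 ^ 2) * ∫⁻ t in Ioo 0 (1 - d), G ((1 - t) • x) :=
          setLIntegral_le_lintegral _ _
      _ = ENNReal.ofReal (r0 ^ 2) * ∫⁻ x, ∫⁻ t in Ioo 0 (1 - d), G ((1 - t) • x) :=
          lintegral_const_mul' _ _ ENNReal.ofReal_ne_top
      _ ≤ _ := by
          gcongr
          exact part_one n hG hd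
  have P2 : ∫ y in B, f (withLast n y 0) ^ 2 ≤ 2 * r0 ^ 2 * ((d ^ n)⁻¹ * r1⁻¹) * K := by
    rw [← ENNReal.ofReal_le_ofReal_iff (by positivity),
      ofReal_integral_eq_lintegral_ofReal (iB (fun y => f (withLast n y 0) ^ 2) ((hfc.comp hwc).pow 2))
      (Filter.Eventually.of_forall fun t => sq_nonneg _), mul_assoc (2 * r0 ^ 2), mul_assoc _ _ K,
      ENNReal.ofReal_mul (by positivity : 0 ≤ 2 * r0 ^ 2),
      ENNReal.ofReal_mul (by positivity : 0 ≤ (d ^ n)⁻¹),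
      ENNReal.ofReal_mul (by positivity : 0 ≤ r1⁻¹), ← hGK]
    calc _ ≤ ∫⁻ y in B, ENNReal.ofReal (2 * r0 ^ 2) *
            ∫⁻ t in Ioo 0 (1 - d), G (withLast n ((1 - t) • y) (t * r1)) := by
          refine setLIntegral_mono' hB fun y hy => ?_
          obtain ⟨hy1, hy2⟩ := hy
          have hy0 : 0 < ‖y‖ := hr1.trans hy1
          have q1 : r1 ^ 2 < ‖y‖ ^ 2 := by gcongr
          have q2 : ‖y‖ ^ 2 < r0 ^ 2 := by gcongr
          have q3 : 0 < r1 ^ 2 := by positivity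
          have ns : ∀ t : ℝ, ‖withLast n ((1 - t) • y) (t * r1)‖ ^ 2 =
              (1 - t) ^ 2 * ‖y‖ ^ 2 + t ^ 2 * r1 ^ 2 := by
            intro t
            rw [withLast_norm_sq, norm_smul, mul_pow, mul_pow, Real.norm_eq_abs, sq_abs]
          have hS : 0 < ‖y‖ ^ 2 + r1 ^ 2 := by positivity
          have hT0 : 0 ≤ (‖y‖ ^ 2 - r1 ^ 2) / (‖y‖ ^ 2 + r1 ^ 2) :=
            div_nonneg (by linarith) hS.le
          have := key (withLast n y 0) (withLast n (-y) r1)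
            ((‖y‖ ^ 2 - r1 ^ 2) / (‖y‖ ^ 2 + r1 ^ 2)) (2 * r0 ^ 2) hT0 ?_ ?_ ?_ ?_
          · simpa only [withLast_line] using this
          · have : (‖y‖ ^ 2 - r1 ^ 2) / (‖y‖ ^ 2 + r1 ^ 2)
                = 1 - 2 * r1 ^ 2 / (‖y‖ ^ 2 + r1 ^ 2) := by field_simp; ring
            rw [this]
            have : d ≤ 2 * r1 ^ 2 / (‖y‖ ^ 2 + r1 ^ 2) := by
              rw [hd_def, div_le_div_iff₀ (by positivity) hS]
              nlinarith
            linarith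
          · rw [withLast_line]
            apply hf0
            · rw [← sq_eq_sq₀ (norm_nonneg _) hr1.le, ns]
              field_simp
              ring
            · rw [withLast_last]; positivity
          · rw [withLast_norm_sq, norm_neg]; linarith
          · intro t ht
            have h1 := ht.2
            rw [lt_div_iff₀ hS] at h1
            have ht0 := ht.1
            have ht1 : t < 1 := by
              by_contra hcon
              push Not at hcon
              nlinarith
            rw [withLast_line]
            refine ⟨⟨?_, ?_⟩, ?_⟩
            · rw [← sq_lt_sq₀ hr1.le (norm_nonneg _), ns]
              nlinarith [mul_pos (sub_pos.2 ht1) (sub_pos.2 h1)]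
            · rw [← sq_lt_sq₀ (norm_nonneg _) hr0.le, ns]
              have a1 : (1 - t) ^ 2 * ‖y‖ ^ 2 < (1 - t) ^ 2 * r0 ^ 2 := by
                have : 0 < (1 - t) ^ 2 := by have := sub_pos.2 ht1; positivity
                gcongr
              have a2 : t ^ 2 * r1 ^ 2 ≤ t ^ 2 * r0 ^ 2 := by gcongr
              have a3 : 0 ≤ t * (1 - t) * r0 ^ 2 := by
                have := sub_pos.2 ht1; positivity
              nlinarith
            · rw [withLast_last]; positivity
      _ ≤ ∫⁻ y, ENNReal.ofReal (2 * r0 ^ 2) *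
            ∫⁻ t in Ioo 0 (1 - d), G (withLast n ((1 - t) • y) (t * r1)) :=
          setLIntegral_le_lintegral _ _
      _ = ENNReal.ofReal (2 * r0 ^ 2) *
            ∫⁻ y, ∫⁻ t in Ioo 0 (1 - d), G (withLast n ((1 - t) • y) (t * r1)) :=
          lintegral_const_mul' _ _ ENNReal.ofReal_ne_top
      _ ≤ _ := by
          gcongr
          exact part_two n hG hd hr1
  linarith
end

section
/- Let n ≥ 3 be a natural number. There exists a constant c > 0 depending only on n (and independent of the radii) such that for all real numbers 0 < r1 < r0 and every continuously differentiable function f : ℝⁿ → ℝ satisfying f(x) = 0 for all x with ‖x‖ = r0, one has (∫_{A(r1,r0)} |f(x)|^{2n/(n−2)} dx)^{(n−2)/n} ≤ c ∫_{A(r1,r0)} ‖∇f(x)‖² dx. -/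
open MeasureTheory Set
open scoped ENNReal

def Ann (n : ℕ) (r1 r0 : ℝ) : Set (EuclideanSpace ℝ (Fin n)) := {x | r1 < ‖x‖ ∧ ‖x‖ < r0}

lemma ann_open (n r1 r0) : IsOpen (Ann n r1 r0) :=
  (isOpen_lt continuous_const continuous_norm).inter (isOpen_lt continuous_norm continuous_const)

lemma norm_upd {n : ℕ} (x : Fin n → ℝ) (i : Fin n) (t : ℝ) :
    ‖(WithLp.toLp 2 (Function.update x i t) : EuclideanSpace ℝ (Fin n))‖ ^ 2
      = ‖(WithLp.toLp 2 x : EuclideanSpace ℝ (Fin n))‖ ^ 2 - x i ^ 2 + t ^ 2 := by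
  rw [EuclideanSpace.norm_sq_eq, EuclideanSpace.norm_sq_eq]
  rw [← Finset.add_sum_erase _ _ (Finset.mem_univ i), ← Finset.add_sum_erase Finset.univ (fun j => ‖(WithLp.toLp 2 x : EuclideanSpace ℝ (Fin n)) j‖ ^ 2) (Finset.mem_univ i)]
  have : ∀ j ∈ Finset.univ.erase i, ‖(WithLp.toLp 2 (Function.update x i t) : EuclideanSpace ℝ (Fin n)) j‖ ^ 2 = ‖(WithLp.toLp 2 x : EuclideanSpace ℝ (Fin n)) j‖ ^ 2 := by
    intro j hj
    simp [Function.update_of_ne (Finset.ne_of_mem_erase hj)]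
  rw [Finset.sum_congr rfl this]
  simp
  ring

lemma ftc {h : ℝ → ℝ} (hh : ContDiff ℝ 1 h) {a b : ℝ} (hab : a ≤ b) :
    ‖h b - h a‖ₑ ≤ ∫⁻ t in Ioo a b, ‖deriv h t‖ₑ := by
  rw [← intervalIntegral.integral_deriv_eq_sub
      (fun t _ => (hh.differentiable one_ne_zero).differentiableAt)
      ((hh.continuous_deriv le_rfl).intervalIntegrable _ _),
    intervalIntegral.integral_of_le hab, ← setLIntegral_congr Ioo_ae_eq_Ioc.symm]
  exact enorm_integral_le_lintegral_enorm _

lemma line_bound_s3 {n : ℕ} {r1 r0 : ℝ} (h1 : 0 < r1) {v : EuclideanSpace ℝ (Fin n) → ℝ}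
    (hv : ContDiff ℝ 1 v) (hz : ∀ x, ‖x‖ = r0 → v x = 0) (x : Fin n → ℝ)
    (hx : WithLp.toLp 2 x ∈ Ann n r1 r0) (i : Fin n) :
    ‖v (WithLp.toLp 2 x)‖ₑ ≤ ∫⁻ t, (Ann n r1 r0).indicator (fun y => ‖fderiv ℝ v y‖ₑ)
      (WithLp.toLp 2 (Function.update x i t)) := by
  set γ : ℝ → EuclideanSpace ℝ (Fin n) := fun t => WithLp.toLp 2 (Function.update x i t) with hγ
  have hγ' : ∀ t, γ t = WithLp.toLp 2 x + (t - x i) • EuclideanSpace.single i (1:ℝ) := by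
    intro t; ext j
    by_cases hj : j = i
    · subst hj; simp [hγ]
    · simp [hγ, hj]
  have hd : ∀ t, HasDerivAt γ (EuclideanSpace.single i (1:ℝ)) t := by
    intro t
    rw [funext hγ']
    simpa using (((hasDerivAt_id t).sub_const (x i)).smul_const (EuclideanSpace.single i (1:ℝ))).const_add (WithLp.toLp 2 x : EuclideanSpace ℝ (Fin n))
  have hc : ContDiff ℝ 1 γ := by
    rw [funext hγ']; fun_prop
  have hg0 : γ (x i) = WithLp.toLp 2 x := by simp [hγ]
  set h : ℝ → ℝ := fun t => v (γ t) with hh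
  have hhc : ContDiff ℝ 1 h := hv.comp hc
  have hder : ∀ t, ‖deriv h t‖ₑ ≤ ‖fderiv ℝ v (γ t)‖ₑ := by
    intro t
    have := ((hv.differentiable one_ne_zero (γ t)).hasFDerivAt.comp_hasDerivAt t (hd t)).deriv
    have e : deriv h t = fderiv ℝ v (γ t) (EuclideanSpace.single i (1:ℝ)) := this
    rw [e]
    refine (ContinuousLinearMap.le_opENorm _ _).trans ?_
    have : ‖(EuclideanSpace.single i (1:ℝ) : EuclideanSpace ℝ (Fin n))‖ₑ = 1 := by
      rw [← ofReal_norm]; simp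
    rw [this, mul_one]
  have hxl : r1 < ‖(WithLp.toLp 2 x : EuclideanSpace ℝ (Fin n))‖ := hx.1
  have hxr : ‖(WithLp.toLp 2 x : EuclideanSpace ℝ (Fin n))‖ < r0 := hx.2
  have hr0 : 0 < r0 := by linarith
  set N := ‖(WithLp.toLp 2 x : EuclideanSpace ℝ (Fin n))‖ with hN
  have hNr : N ^ 2 < r0 ^ 2 := by nlinarith
  set T := Real.sqrt (r0 ^ 2 - N ^ 2 + x i ^ 2) with hT
  have hT2 : T ^ 2 = r0 ^ 2 - N ^ 2 + x i ^ 2 := Real.sq_sqrt (by nlinarith [sq_nonneg (x i)])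
  have hT0 : 0 ≤ T := Real.sqrt_nonneg _
  have hiT : |x i| < T := abs_lt_of_sq_lt_sq (by linarith) hT0
  have hend : ∀ t, t ^ 2 = T ^ 2 → h t = 0 := by
    intro t ht
    apply hz
    have := norm_upd x i t
    rw [ht, hT2] at this
    have h3 : ‖γ t‖ ^ 2 = r0 ^ 2 := by rw [this]; ring
    exact (sq_eq_sq₀ (norm_nonneg _) hr0.le).1 h3
  have hmem : ∀ t, x i ^ 2 ≤ t ^ 2 → t ^ 2 < T ^ 2 → γ t ∈ Ann n r1 r0 := by
    intro t ht1 ht2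
    have := norm_upd x i t
    constructor
    · refine lt_of_lt_of_le hxl ((sq_le_sq₀ (norm_nonneg _) (norm_nonneg _)).1 ?_)
      rw [this]; linarith
    · refine (sq_lt_sq₀ (norm_nonneg _) hr0.le).1 ?_
      rw [this]; linarith
  have key : ∀ a b, (∀ t ∈ Ioo a b, γ t ∈ Ann n r1 r0) → ∫⁻ t in Ioo a b, ‖deriv h t‖ₑ ≤
      ∫⁻ t, (Ann n r1 r0).indicator (fun y => ‖fderiv ℝ v y‖ₑ) (γ t) := by
    intro a b hab
    refine le_trans (setLIntegral_mono' measurableSet_Ioo fun t ht => ?_)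
      (setLIntegral_le_lintegral (Ioo a b) _)
    rw [indicator_of_mem (hab t ht)]
    exact hder t
  have hxi := abs_lt.1 hiT
  rw [← hg0]
  rcases le_total 0 (x i) with hs | hs
  · have := (ftc hhc hxi.2.le).trans (key (x i) T fun t ht => hmem t (by nlinarith [ht.1]) (by nlinarith [ht.1, ht.2]))
    rwa [hend T rfl, zero_sub, enorm_neg] at this
  · have := (ftc hhc hxi.1.le).trans (key (-T) (x i) fun t ht => hmem t (by nlinarith [ht.2]) (by nlinarith [ht.1, ht.2]))
    rwa [hend (-T) (by ring), sub_zero] at this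

lemma L1 {n : ℕ} (hn : 3 ≤ n) {r1 r0 : ℝ} (h1 : 0 < r1) {v : EuclideanSpace ℝ (Fin n) → ℝ}
    (hv : ContDiff ℝ 1 v) (hz : ∀ x, ‖x‖ = r0 → v x = 0) :
    ∫⁻ x in Ann n r1 r0, ‖v x‖ₑ ^ ((n : ℝ) / (n - 1)) ≤
      (∫⁻ x in Ann n r1 r0, ‖fderiv ℝ v x‖ₑ) ^ ((n : ℝ) / (n - 1)) := by
  have hn' : (3 : ℝ) ≤ n := by exact_mod_cast hn
  have hm := (ann_open n r1 r0).measurableSet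
  set p : ℝ := (n : ℝ) / (n - 1) with hp
  have hp0 : 0 < p := div_pos (by linarith) (by linarith)
  have hpc : Real.HolderConjugate (Fintype.card (Fin n)) p := by
    rw [Fintype.card_fin]
    exact Real.HolderConjugate.conjExponent (by linarith)
  have hcont : Continuous (fderiv ℝ v) := hv.continuous_fderiv one_ne_zero
  have hmeas : Measurable ((Ann n r1 r0).indicator (fun y => ‖fderiv ℝ v y‖ₑ)) :=
    (hcont.enorm.measurable).indicator hm
  have hmeasv : Measurable ((Ann n r1 r0).indicator (fun y => ‖v y‖ₑ ^ p)) :=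
    ((hv.continuous.enorm.measurable).pow_const p).indicator hm
  have mp := PiLp.volume_preserving_toLp (Fin n)
  rw [← lintegral_indicator hm, ← lintegral_indicator hm,
    ← mp.lintegral_comp hmeas, ← mp.lintegral_comp hmeasv]
  refine le_trans ?_ (lintegral_prod_lintegral_pow_le (fun _ : Fin n => (volume : Measure ℝ)) hpc
    (hmeas.comp mp.measurable))
  refine lintegral_mono fun x => ?_
  by_cases hx : WithLp.toLp 2 x ∈ Ann n r1 r0
  · rw [indicator_of_mem hx]
    calc ‖v (WithLp.toLp 2 x)‖ₑ ^ p
        = ∏ _i : Fin n, ‖v (WithLp.toLp 2 x)‖ₑ ^ ((1 : ℝ) / ((Fintype.card (Fin n) : ℝ) - 1)) := by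
          rw [Finset.prod_const, Finset.card_univ, Fintype.card_fin, ← ENNReal.rpow_natCast,
            ← ENNReal.rpow_mul]
          congr 1
          rw [hp]; ring
      _ ≤ _ := by
          refine Finset.prod_le_prod' fun i _ => ?_
          refine ENNReal.rpow_le_rpow (line_bound_s3 h1 hv hz x hx i) ?_
          rw [Fintype.card_fin]
          exact div_nonneg zero_le_one (by linarith)
  · rw [indicator_of_notMem hx]; exact zero_le

lemma L2 {n : ℕ} (hn : 3 ≤ n) {r1 r0 : ℝ} (h1 : 0 < r1) {f : EuclideanSpace ℝ (Fin n) → ℝ}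
    (hf : ContDiff ℝ 1 f) (hz : ∀ x, ‖x‖ = r0 → f x = 0) :
    ∫⁻ x in Ann n r1 r0, ‖f x‖ₑ ^ ((2 * n : ℝ) / (n - 2)) ≤
      (ENNReal.ofReal (2 * (n - 1) / (n - 2)) * ((∫⁻ x in Ann n r1 r0, ‖f x‖ₑ ^ ((2 * n : ℝ) / (n - 2))) ^ (1 / 2 : ℝ)
       * (∫⁻ x in Ann n r1 r0, ‖fderiv ℝ f x‖ₑ ^ (2 : ℝ)) ^ (1 / 2 : ℝ))) ^ ((n : ℝ) / (n - 1)) := by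
  have hn' : (3 : ℝ) ≤ n := by exact_mod_cast hn
  have a1 : (0:ℝ) < n - 1 := by linarith
  have a2 : (0:ℝ) < n - 2 := by linarith
  set g : ℝ := 2 * (n - 1) / (n - 2) with hg
  have hg1 : 1 < g := by rw [hg, lt_div_iff₀ a2]; linarith
  have hv : ContDiff ℝ 1 (fun x => ‖f x‖ ^ g) := hf.norm_rpow hg1
  have main := L1 hn (r0 := r0) h1 hv (fun x hx => by
    simp only [hz x hx, norm_zero]; exact Real.zero_rpow (by linarith))
  have e1 : ∀ x, ‖(‖f x‖ ^ g)‖ₑ = ‖f x‖ₑ ^ g := by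
    intro x
    rw [Real.enorm_rpow_of_nonneg (norm_nonneg _) (by linarith), enorm_norm]
  have e2 : ∀ x, ‖(‖f x‖ ^ g)‖ₑ ^ ((n : ℝ) / (n - 1)) = ‖f x‖ₑ ^ ((2 * n : ℝ) / (n - 2)) := by
    intro x
    rw [e1, ← ENNReal.rpow_mul]
    congr 1
    rw [hg]; field_simp
  simp_rw [e2] at main
  refine main.trans (ENNReal.rpow_le_rpow ?_ (by positivity))
  have e3 : ∀ x, ‖fderiv ℝ (fun x => ‖f x‖ ^ g) x‖ₑ ≤
      ENNReal.ofReal g * (‖f x‖ₑ ^ (g - 1) * ‖fderiv ℝ f x‖ₑ) := by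
    intro x
    have := enorm_fderiv_norm_rpow_le (hf.differentiable one_ne_zero) (x := x)
      (p := ⟨g, by linarith⟩) (by exact_mod_cast hg1)
    have hgp : 0 ≤ g := by linarith
    rw [← mul_assoc, ENNReal.ofReal_eq_coe_nnreal hgp]
    exact this
  have hmf : Measurable fun x => ‖f x‖ₑ ^ (g - 1) := (hf.continuous.enorm.measurable).pow_const _
  have hmd : Measurable fun x => ‖fderiv ℝ f x‖ₑ :=
    (hf.continuous_fderiv one_ne_zero).enorm.measurable
  refine (lintegral_mono e3).trans ?_
  rw [lintegral_const_mul _ (by fun_prop)]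
  gcongr
  have H := ENNReal.lintegral_mul_le_Lp_mul_Lq (volume.restrict (Ann n r1 r0))
    (p := 2) (q := 2) Real.HolderConjugate.two_two hmf.aemeasurable hmd.aemeasurable
  have e4 : ∀ x, (‖f x‖ₑ ^ (g - 1)) ^ (2 : ℝ) = ‖f x‖ₑ ^ ((2 * n : ℝ) / (n - 2)) := by
    intro x
    rw [← ENNReal.rpow_mul]
    congr 1
    rw [hg]; field_simp; ring
  simp_rw [e4] at H
  exact H

theorem annulus_sobolev (n : ℕ) (hn : 3 ≤ n) :
    ∃ c : ℝ, 0 < c ∧ ∀ r1 r0 : ℝ, 0 < r1 → r1 < r0 →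
      ∀ f : EuclideanSpace ℝ (Fin n) → ℝ, ContDiff ℝ 1 f →
      (∀ x : EuclideanSpace ℝ (Fin n), ‖x‖ = r0 → f x = 0) →
      (∫ x in {x : EuclideanSpace ℝ (Fin n) | r1 < ‖x‖ ∧ ‖x‖ < r0},
          |f x| ^ ((2 * n : ℝ) / ((n : ℝ) - 2))) ^ (((n : ℝ) - 2) / (n : ℝ))
        ≤ c * ∫ x in {x : EuclideanSpace ℝ (Fin n) | r1 < ‖x‖ ∧ ‖x‖ < r0},
            ‖fderiv ℝ f x‖ ^ 2 := by
  have hn' : (3 : ℝ) ≤ n := by exact_mod_cast hn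
  have a1 : (0:ℝ) < n - 1 := by linarith
  have a2 : (0:ℝ) < n - 2 := by linarith
  have a0 : (0:ℝ) < n := by linarith
  have hg0 : (0:ℝ) < 2 * (n - 1) / (n - 2) := by positivity
  refine ⟨(2 * (n - 1) / (n - 2)) ^ 2, by positivity, ?_⟩
  intro r1 r0 h1 h10 f hf hz
  have main := L2 hn h1 hf hz
  change (∫ x in Ann n r1 r0, |f x| ^ ((2 * n : ℝ) / ((n : ℝ) - 2))) ^ (((n : ℝ) - 2) / (n : ℝ))
        ≤ _ * ∫ x in Ann n r1 r0, ‖fderiv ℝ f x‖ ^ 2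
  set q : ℝ := (2 * n : ℝ) / ((n : ℝ) - 2) with hq
  have hq0 : 0 < q := by positivity
  set g : ℝ := 2 * (n - 1) / (n - 2) with hg
  have hsub : Ann n r1 r0 ⊆ Metric.closedBall 0 r0 := fun x hx => by
    simpa using hx.2.le
  have hint : ∀ u : EuclideanSpace ℝ (Fin n) → ℝ, Continuous u → IntegrableOn u (Ann n r1 r0) :=
    fun u hu => (hu.continuousOn.integrableOn_compact (isCompact_closedBall _ _)).mono_set hsub
  have i1 := hint (fun x => |f x| ^ q) (hf.continuous.abs.rpow_const fun _ => Or.inr hq0.le)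
  have i2 := hint (fun x => ‖fderiv ℝ f x‖ ^ 2) ((hf.continuous_fderiv one_ne_zero).norm.pow 2)
  have E1 : ∫⁻ x in Ann n r1 r0, ‖f x‖ₑ ^ q = ENNReal.ofReal (∫ x in Ann n r1 r0, |f x| ^ q) := by
    rw [ofReal_integral_eq_lintegral_ofReal i1 (ae_of_all _ fun x => by positivity)]
    refine lintegral_congr fun x => ?_
    rw [← ENNReal.ofReal_rpow_of_nonneg (abs_nonneg _) hq0.le, Real.enorm_eq_ofReal_abs]
  have E2 : ∫⁻ x in Ann n r1 r0, ‖fderiv ℝ f x‖ₑ ^ (2:ℝ) =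
      ENNReal.ofReal (∫ x in Ann n r1 r0, ‖fderiv ℝ f x‖ ^ 2) := by
    rw [ofReal_integral_eq_lintegral_ofReal i2 (ae_of_all _ fun x => by positivity)]
    refine lintegral_congr fun x => ?_
    rw [ENNReal.ofReal_pow (norm_nonneg _), ofReal_norm, ENNReal.rpow_two]
  rw [E1, E2] at main
  have I0 : 0 ≤ ∫ x in Ann n r1 r0, |f x| ^ q := integral_nonneg fun x => by positivity
  have J0 : 0 ≤ ∫ x in Ann n r1 r0, ‖fderiv ℝ f x‖ ^ 2 := integral_nonneg fun x => by positivity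
  generalize (∫ x in Ann n r1 r0, |f x| ^ q) = I at *
  generalize (∫ x in Ann n r1 r0, ‖fderiv ℝ f x‖ ^ 2) = J at *
  rw [ENNReal.ofReal_rpow_of_nonneg I0 (by norm_num), ENNReal.ofReal_rpow_of_nonneg J0 (by norm_num),
    ← ENNReal.ofReal_mul (by positivity), ← ENNReal.ofReal_mul (by positivity),
    ENNReal.ofReal_rpow_of_nonneg (by positivity) (by positivity),
    ENNReal.ofReal_le_ofReal_iff (by positivity)] at main
  rcases I0.eq_or_lt with hI | hI
  · rw [← hI, Real.zero_rpow (by positivity)]; positivity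
  have m2 : I ^ (((n:ℝ) - 1) / n) ≤ g * (I ^ (1 / 2 : ℝ) * J ^ (1 / 2 : ℝ)) := by
    have := Real.rpow_le_rpow I0 main (z := ((n:ℝ) - 1) / n) (by positivity)
    rwa [← Real.rpow_mul (by positivity), show (n:ℝ) / (n - 1) * ((n - 1) / n) = 1 by field_simp,
      Real.rpow_one] at this
  have m3 : I ^ (((n:ℝ) - 2) / (2 * n)) ≤ g * J ^ (1 / 2 : ℝ) := by
    have hs : ((n:ℝ) - 1) / n = (n - 2) / (2 * n) + 1 / 2 := by field_simp; ring
    rw [hs, Real.rpow_add hI] at m2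
    have hp : 0 < I ^ (1 / 2 : ℝ) := by positivity
    refine le_of_mul_le_mul_right (m2.trans_eq ?_) hp
    ring
  have m4 := pow_le_pow_left₀ (by positivity) m3 2
  rw [mul_pow, ← Real.rpow_natCast (I ^ _), ← Real.rpow_natCast (J ^ _), ← Real.rpow_mul I0,
    ← Real.rpow_mul J0] at m4
  have k1 : ((n:ℝ) - 2) / (2 * n) * ((2:ℕ) : ℝ) = (n - 2) / n := by push_cast; field_simp
  have k2 : (1 / 2 : ℝ) * ((2:ℕ) : ℝ) = 1 := by norm_num
  rwa [k1, k2, Real.rpow_one] at m4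
end

section
/- Let n ≥ 3 be a natural number. There exists a constant c > 0 depending only on n such that for all real numbers 0 < r1 < r0 and every continuously differentiable function f : ℝⁿ → ℝ satisfying f(x) = 0 for all x = (y,s) with ‖x‖ = r0 and s ≥ 0 (writing the last coordinate of x as s), one has (∫_{A⁺} |f(x)|^{2n/(n−2)} dx)^{(n−2)/n} ≤ c ∫_{A⁺} ‖∇f(x)‖² dx, where A⁺ = {x ∈ ℝⁿ : r1 < ‖x‖ < r0, s > 0} is the open upper half-annulus. -/
open MeasureTheory

lemma hs_norm_update {n : ℕ} (x : Fin n → ℝ) (i : Fin n) (t : ℝ) :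
    ‖(WithLp.toLp 2 (Function.update x i t) : EuclideanSpace ℝ (Fin n))‖ ^ 2
      = t ^ 2 + ∑ j ∈ Finset.univ.erase i, x j ^ 2 := by
  rw [EuclideanSpace.real_norm_sq_eq, ← Finset.add_sum_erase _ _ (Finset.mem_univ i)]
  congr 1
  · simp
  · refine Finset.sum_congr rfl fun j hj => ?_
    simp [Function.update_of_ne (Finset.ne_of_mem_erase hj)]

lemma hs_hasDeriv {n : ℕ} (x : Fin n → ℝ) (i : Fin n) (t : ℝ) :
    HasDerivAt (fun t => (WithLp.toLp 2 (Function.update x i t) : EuclideanSpace ℝ (Fin n)))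
      (EuclideanSpace.single i (1 : ℝ)) t := by
  have h : (fun t => (WithLp.toLp 2 (Function.update x i t) : EuclideanSpace ℝ (Fin n)))
      = fun t => WithLp.toLp 2 x + (t - x i) • EuclideanSpace.single i (1 : ℝ) := by
    funext t
    ext j
    by_cases hj : j = i
    · subst hj; simp
    · simp [hj]
  rw [h]
  have := ((((hasDerivAt_id t).sub_const (x i)).smul_const
    (EuclideanSpace.single i (1 : ℝ) : EuclideanSpace ℝ (Fin n))).const_add (WithLp.toLp 2 x))
  simpa using this

lemma hs_line {n : ℕ} {v : EuclideanSpace ℝ (Fin n) → ℝ} (hv : ContDiff ℝ 1 v)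
    (A : Set (EuclideanSpace ℝ (Fin n))) (x : Fin n → ℝ) (i : Fin n) (a b : ℝ) (hab : a ≤ b)
    (hA : ∀ t ∈ Set.Ioo a b, WithLp.toLp 2 (Function.update x i t) ∈ A) :
    ‖v (WithLp.toLp 2 (Function.update x i b)) - v (WithLp.toLp 2 (Function.update x i a))‖ₑ ≤
      ∫⁻ t, A.indicator (fun y => ‖fderiv ℝ v y‖ₑ) (WithLp.toLp 2 (Function.update x i t)) := by
  have hc : ContDiff ℝ 1
      (fun t => (WithLp.toLp 2 (Function.update x i t) : EuclideanSpace ℝ (Fin n))) := by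
    have h1 : ContDiff ℝ 1 (Function.update x i) := contDiff_update 1 x i
    exact (PiLp.contDiff_toLp (𝕜 := ℝ) (p := 2)).comp h1
  have h := enorm_sub_le_lintegral_deriv_of_contDiffOn_Icc (f := fun t =>
    v (WithLp.toLp 2 (Function.update x i t))) (hv.comp hc).contDiffOn hab
  refine h.trans ?_
  rw [← restrict_Ioo_eq_restrict_Icc]
  refine le_trans ?_ (setLIntegral_le_lintegral (Set.Ioo a b) _)
  refine setLIntegral_mono' measurableSet_Ioo fun t ht => ?_
  rw [Set.indicator_of_mem (hA t ht)]
  have hd := ((hv.differentiable one_ne_zero _).hasFDerivAt.comp_hasDerivAt t (hs_hasDeriv x i t))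
  have hd' := hd.deriv
  simp only [Function.comp_def] at hd'
  rw [hd']
  refine (ContinuousLinearMap.le_opENorm _ _).trans ?_
  have : ‖(EuclideanSpace.single i (1 : ℝ) : EuclideanSpace ℝ (Fin n))‖ₑ = 1 := by
    rw [← ofReal_norm]; simp
  rw [this, mul_one]

/-- the half annulus -/
def hsA {n : ℕ} (l : Fin n) (r1 r0 : ℝ) : Set (EuclideanSpace ℝ (Fin n)) :=
  {x | (r1 < ‖x‖ ∧ ‖x‖ < r0) ∧ 0 < x l}

lemma hs_meas {n : ℕ} (l : Fin n) (r1 r0 : ℝ) : MeasurableSet (hsA l r1 r0) := by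
  have h1 : Continuous fun x : EuclideanSpace ℝ (Fin n) => x l := by fun_prop
  exact (((isOpen_lt continuous_const continuous_norm).inter
    (isOpen_lt continuous_norm continuous_const)).inter
    (isOpen_lt continuous_const h1)).measurableSet

lemma hs_pt {n : ℕ} (l : Fin n) {r1 r0 : ℝ} (h1 : 0 < r1) (h10 : r1 < r0)
    {v : EuclideanSpace ℝ (Fin n) → ℝ} (hv : ContDiff ℝ 1 v)
    (hv0 : ∀ x : EuclideanSpace ℝ (Fin n), ‖x‖ = r0 → 0 ≤ x l → v x = 0)
    (x : Fin n → ℝ) (hx : WithLp.toLp 2 x ∈ hsA l r1 r0) (i : Fin n) :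
    ‖v (WithLp.toLp 2 x)‖ₑ ≤
      ∫⁻ t, (hsA l r1 r0).indicator (fun y => ‖fderiv ℝ v y‖ₑ)
        (WithLp.toLp 2 (Function.update x i t)) := by
  obtain ⟨⟨hx1, hx0⟩, hxl⟩ := hx
  have hself : Function.update x i (x i) = x := Function.update_eq_self i x
  have hN := hs_norm_update x i (x i)
  rw [hself] at hN
  set N := ∑ j ∈ Finset.univ.erase i, x j ^ 2 with hNdef
  have hr1 : r1 ^ 2 < x i ^ 2 + N := by rw [← hN]; gcongr
  have hr0 : x i ^ 2 + N < r0 ^ 2 := by rw [← hN]; gcongr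
  set T := √(r0 ^ 2 - N) with hT
  have hT2 : T ^ 2 = r0 ^ 2 - N := Real.sq_sqrt (by nlinarith [sq_nonneg (x i)])
  have hT0 : 0 ≤ T := Real.sqrt_nonneg _
  have hxT : |x i| < T := by
    refine abs_lt_of_sq_lt_sq ?_ hT0
    linarith
  have hend : ∀ t, t ^ 2 = T ^ 2 →
      ‖(WithLp.toLp 2 (Function.update x i t) : EuclideanSpace ℝ (Fin n))‖ = r0 := by
    intro t ht
    have := hs_norm_update x i t
    rw [ht, hT2] at this
    rw [← sq_eq_sq₀ (norm_nonneg _) (by linarith)]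
    rw [this]; ring
  have hmid : ∀ t, x i ^ 2 ≤ t ^ 2 → t ^ 2 < T ^ 2 → 0 < (Function.update x i t) l →
      WithLp.toLp 2 (Function.update x i t) ∈ hsA l r1 r0 := by
    intro t ha hb hl
    have := hs_norm_update x i t
    refine ⟨⟨?_, ?_⟩, hl⟩
    · apply lt_of_pow_lt_pow_left₀ 2 (norm_nonneg _); rw [this]; linarith
    · apply lt_of_pow_lt_pow_left₀ 2 (by linarith); rw [this]; linarith
  have hxl' : 0 < x l := hxl
  rcases le_or_gt 0 (x i) with hi | hi
  · rw [abs_of_nonneg hi] at hxT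
    have hpos : ∀ t, x i ≤ t → 0 < (Function.update x i t) l := by
      intro t ht
      by_cases hli : l = i
      · subst hli; simp; linarith
      · simpa [Function.update_of_ne hli] using hxl'
    have := hs_line hv (hsA l r1 r0) x i (x i) T hxT.le (by
      intro t ht
      exact hmid t (by gcongr; exact ht.1.le) (by have := ht.1; have := ht.2; gcongr; linarith)
        (hpos t ht.1.le))
    rwa [hself, hv0 _ (hend T rfl) (hpos T hxT.le).le, zero_sub, enorm_neg] at this
  · rw [abs_of_neg hi] at hxT
    have hpos : ∀ t, 0 < (Function.update x i t) l := by
      intro t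
      by_cases hli : l = i
      · subst hli; linarith
      · simpa [Function.update_of_ne hli] using hxl'
    have := hs_line hv (hsA l r1 r0) x i (-T) (x i) (by linarith) (by
      intro t ht
      have h1 := ht.1
      have h2 := ht.2
      exact hmid t (by nlinarith) (by nlinarith) (hpos t))
    rwa [hself, hv0 _ (hend (-T) (by ring)) (hpos _).le, sub_zero] at this

lemma hs_one {n : ℕ} (hn : 3 ≤ n) (l : Fin n) {r1 r0 : ℝ} (h1 : 0 < r1) (h10 : r1 < r0)
    {v : EuclideanSpace ℝ (Fin n) → ℝ} (hv : ContDiff ℝ 1 v)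
    (hv0 : ∀ x : EuclideanSpace ℝ (Fin n), ‖x‖ = r0 → 0 ≤ x l → v x = 0)
    {p : ℝ} (hp : Real.HolderConjugate n p) :
    ∫⁻ x in hsA l r1 r0, ‖v x‖ₑ ^ p ≤ (∫⁻ x in hsA l r1 r0, ‖fderiv ℝ v x‖ₑ) ^ p := by
  have hn' : (3 : ℝ) ≤ n := by exact_mod_cast hn
  have hA := hs_meas l r1 r0
  have hp0 : 0 < p := hp.symm.pos
  have hmp := PiLp.volume_preserving_toLp (Fin n)
  have hme : MeasurableEmbedding (WithLp.toLp 2 : (Fin n → ℝ) → EuclideanSpace ℝ (Fin n)) :=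
    (MeasurableEquiv.toLp 2 (Fin n → ℝ)).measurableEmbedding
  rw [← lintegral_indicator hA, ← lintegral_indicator hA]
  rw [← hmp.lintegral_comp_emb hme, ← hmp.lintegral_comp_emb hme]
  set g : (Fin n → ℝ) → ENNReal := fun x =>
    (hsA l r1 r0).indicator (fun y => ‖fderiv ℝ v y‖ₑ) (WithLp.toLp 2 x) with hg
  have hgm : Measurable g := by
    have : Measurable (fun y => ‖fderiv ℝ v y‖ₑ) :=
      (hv.continuous_fderiv one_ne_zero).measurable.enorm
    exact (this.indicator hA).comp hme.measurable
  have hp' : Real.HolderConjugate (Fintype.card (Fin n)) p := by simpa using hp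
  have key := lintegral_prod_lintegral_pow_le (fun _ : Fin n => (volume : Measure ℝ)) hp' hgm
  refine le_trans ?_ key
  refine lintegral_mono fun x => ?_
  by_cases hx : WithLp.toLp 2 x ∈ hsA l r1 r0
  · rw [Set.indicator_of_mem hx]
    calc ‖v (WithLp.toLp 2 x)‖ₑ ^ p
        = ∏ _i : Fin n, ‖v (WithLp.toLp 2 x)‖ₑ ^ (1 / ((Fintype.card (Fin n) : ℝ) - 1)) := by
          rw [Finset.prod_const, ← ENNReal.rpow_natCast, ← ENNReal.rpow_mul, hp.conjugate_eq]
          congr 1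
          simp
          field_simp
      _ ≤ _ := by
          have hc : (0 : ℝ) ≤ 1 / ((Fintype.card (Fin n) : ℝ) - 1) := by
            simp; linarith
          refine Finset.prod_le_prod' fun i _ => ENNReal.rpow_le_rpow ?_ hc
          exact hs_pt l h1 h10 hv hv0 x hx i
  · rw [Set.indicator_of_notMem hx]; exact zero_le

lemma hs_main {n : ℕ} (hn : 3 ≤ n) (l : Fin n) {r1 r0 : ℝ} (h1 : 0 < r1) (h10 : r1 < r0)
    {f : EuclideanSpace ℝ (Fin n) → ℝ} (hf : ContDiff ℝ 1 f)
    (hf0 : ∀ x : EuclideanSpace ℝ (Fin n), ‖x‖ = r0 → 0 ≤ x l → f x = 0)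
    (γ : NNReal) (hγ : (γ : ℝ) = 2 * (n - 1) / (n - 2))
    (hI : ∫⁻ x in hsA l r1 r0, ‖f x‖ₑ ^ ((2 * n : ℝ) / ((n : ℝ) - 2)) ≠ ⊤) :
    (∫⁻ x in hsA l r1 r0, ‖f x‖ₑ ^ ((2 * n : ℝ) / ((n : ℝ) - 2))) ^ (((n : ℝ) - 2) / n)
      ≤ γ ^ 2 * ∫⁻ x in hsA l r1 r0, ‖fderiv ℝ f x‖ₑ ^ (2 : ℝ) := by
  have hn' : (3 : ℝ) ≤ n := by exact_mod_cast hn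
  have hn2 : (0 : ℝ) < n - 2 := by linarith
  have hn1 : (0 : ℝ) < n - 1 := by linarith
  have hn0 : (0 : ℝ) < n := by linarith
  have hγ1 : 1 < (γ : ℝ) := by rw [hγ, lt_div_iff₀ hn2]; linarith
  have hγ1' : 1 < γ := by exact_mod_cast hγ1
  set q : ℝ := (2 * n : ℝ) / ((n : ℝ) - 2) with hq
  set I := ∫⁻ x in hsA l r1 r0, ‖f x‖ₑ ^ q with hIdef
  set J := ∫⁻ x in hsA l r1 r0, ‖fderiv ℝ f x‖ₑ ^ (2 : ℝ) with hJdef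
  by_cases hI0 : I = 0
  · rw [hI0, ENNReal.zero_rpow_of_pos (by positivity)]; exact zero_le
  let p : ℝ := Real.conjExponent n
  have hp : Real.HolderConjugate n p := .conjExponent (by linarith)
  have hpe : p = n / (n - 1) := rfl
  have hp0 : 0 < p := hp.symm.pos
  have hfm : Measurable fun x => ‖f x‖ₑ := hf.continuous.measurable.enorm
  have hdm : Measurable fun x => ‖fderiv ℝ f x‖ₑ :=
    (hf.continuous_fderiv one_ne_zero).measurable.enorm
  have hone := hs_one hn l h1 h10 (hf.norm_rpow hγ1)
    (fun x hx hl => by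
      rw [hf0 x hx hl, norm_zero, Real.zero_rpow (by linarith)]) hp
  have hL : ∫⁻ x in hsA l r1 r0, ‖‖f x‖ ^ (γ : ℝ)‖ₑ ^ p = I := by
    refine lintegral_congr fun x => ?_
    rw [Real.enorm_rpow_of_nonneg (norm_nonneg _) (by linarith), enorm_norm, ← ENNReal.rpow_mul]
    congr 1
    rw [hγ, hpe, hq]; field_simp
  rw [hL] at hone
  have hR : ∫⁻ x in hsA l r1 r0, ‖fderiv ℝ (fun x => ‖f x‖ ^ (γ : ℝ)) x‖ₑ
      ≤ γ * (I ^ (1 / 2 : ℝ) * J ^ (1 / 2 : ℝ)) := by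
    calc _ ≤ ∫⁻ x in hsA l r1 r0, γ * (‖f x‖ₑ ^ ((γ : ℝ) - 1) * ‖fderiv ℝ f x‖ₑ) := by
          refine lintegral_mono fun x => ?_
          rw [← mul_assoc]
          exact enorm_fderiv_norm_rpow_le (hf.differentiable one_ne_zero) hγ1'
      _ = γ * ∫⁻ x in hsA l r1 r0, (‖f x‖ₑ ^ ((γ : ℝ) - 1) * ‖fderiv ℝ f x‖ₑ) := by
          rw [lintegral_const_mul]
          exact (hfm.pow_const _).mul hdm
      _ ≤ _ := by
          gcongr
          have := ENNReal.lintegral_mul_le_Lp_mul_Lq (volume.restrict (hsA l r1 r0))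
            Real.HolderConjugate.two_two (hfm.pow_const ((γ : ℝ) - 1)).aemeasurable
            hdm.aemeasurable
          refine this.trans_eq ?_
          congr 2
          refine lintegral_congr fun x => ?_
          rw [← ENNReal.rpow_mul]
          congr 1
          rw [hγ, hq]; field_simp; ring
  have h2 : I ^ p⁻¹ ≤ γ * (I ^ (1 / 2 : ℝ) * J ^ (1 / 2 : ℝ)) := by
    refine le_trans ?_ hR
    rw [ENNReal.rpow_inv_le_iff hp0]; exact hone
  have hIh0 : I ^ (1 / 2 : ℝ) ≠ 0 := by
    rw [Ne, ENNReal.rpow_eq_zero_iff]; simp [hI0, hI]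
  have hIht : I ^ (1 / 2 : ℝ) ≠ ⊤ := ENNReal.rpow_ne_top_of_nonneg (by norm_num) hI
  have h3 : I ^ (p⁻¹ - 1 / 2) ≤ γ * J ^ (1 / 2 : ℝ) := by
    rw [ENNReal.rpow_sub _ _ hI0 hI, ENNReal.div_le_iff hIh0 hIht]
    refine h2.trans_eq ?_
    ring
  have h4 := ENNReal.rpow_le_rpow h3 (z := 2) (by norm_num)
  rw [ENNReal.mul_rpow_of_nonneg _ _ (by norm_num), ← ENNReal.rpow_mul, ← ENNReal.rpow_mul] at h4
  convert h4 using 2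
  · rw [hpe]; field_simp; ring
  · norm_num
  · norm_num

/-- Sobolev inequality on a Euclidean half-annulus for functions vanishing on the outer
(half-)sphere, with constant depending only on the dimension (Lemma 4.1(2) of the paper). -/
theorem half_annulus_sobolev (n : ℕ) (hn : 3 ≤ n) :
    ∃ c : ℝ, 0 < c ∧ ∀ r1 r0 : ℝ, 0 < r1 → r1 < r0 →
      ∀ f : EuclideanSpace ℝ (Fin n) → ℝ, ContDiff ℝ 1 f →
      (∀ x : EuclideanSpace ℝ (Fin n), ‖x‖ = r0 → 0 ≤ x ⟨n - 1, by omega⟩ → f x = 0) →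
      (∫ x in {x : EuclideanSpace ℝ (Fin n) |
            (r1 < ‖x‖ ∧ ‖x‖ < r0) ∧ 0 < x ⟨n - 1, by omega⟩},
          |f x| ^ ((2 * n : ℝ) / ((n : ℝ) - 2))) ^ (((n : ℝ) - 2) / (n : ℝ))
        ≤ c * ∫ x in {x : EuclideanSpace ℝ (Fin n) |
              (r1 < ‖x‖ ∧ ‖x‖ < r0) ∧ 0 < x ⟨n - 1, by omega⟩},
            ‖fderiv ℝ f x‖ ^ 2 := by
  have hn' : (3 : ℝ) ≤ n := by exact_mod_cast hn
  have hn2 : (0 : ℝ) < n - 2 := by linarith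
  have hn1 : (0 : ℝ) < n - 1 := by linarith
  have hn0 : (0 : ℝ) < n := by linarith
  have hγ0 : (0 : ℝ) < 2 * (n - 1) / (n - 2) := by positivity
  obtain ⟨γ, hγ⟩ : ∃ γ : NNReal, (γ : ℝ) = 2 * (n - 1) / (n - 2) := ⟨⟨_, hγ0.le⟩, rfl⟩
  refine ⟨(γ : ℝ) ^ 2, by rw [hγ]; positivity, ?_⟩
  intro r1 r0 h1 h10 f hf hf0
  set l : Fin n := ⟨n - 1, by omega⟩ with hl
  change (∫ x in hsA l r1 r0, |f x| ^ ((2 * n : ℝ) / ((n : ℝ) - 2))) ^ (((n : ℝ) - 2) / (n : ℝ))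
    ≤ (γ : ℝ) ^ 2 * ∫ x in hsA l r1 r0, ‖fderiv ℝ f x‖ ^ 2
  have hq0 : (0 : ℝ) ≤ (2 * n : ℝ) / ((n : ℝ) - 2) := by positivity
  have hsub : hsA l r1 r0 ⊆ Metric.closedBall 0 r0 := by
    intro x hx
    simpa using hx.1.2.le
  have hcI : Continuous fun x => |f x| ^ ((2 * n : ℝ) / ((n : ℝ) - 2)) :=
    hf.continuous.abs.rpow_const fun _ => Or.inr hq0
  have hcJ : Continuous fun x => ‖fderiv ℝ f x‖ ^ 2 :=
    (hf.continuous_fderiv one_ne_zero).norm.pow 2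
  have hiI := (hcI.continuousOn.integrableOn_compact (μ := volume)
    (isCompact_closedBall (0 : EuclideanSpace ℝ (Fin n)) r0)).mono_set hsub
  have hiJ := (hcJ.continuousOn.integrableOn_compact (μ := volume)
    (isCompact_closedBall (0 : EuclideanSpace ℝ (Fin n)) r0)).mono_set hsub
  have eI := ofReal_integral_eq_lintegral_ofReal hiI
    (Filter.Eventually.of_forall fun x => by positivity)
  have eJ := ofReal_integral_eq_lintegral_ofReal hiJ
    (Filter.Eventually.of_forall fun x => by positivity)
  have eI' : ENNReal.ofReal (∫ x in hsA l r1 r0, |f x| ^ ((2 * n : ℝ) / ((n : ℝ) - 2)))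
      = ∫⁻ x in hsA l r1 r0, ‖f x‖ₑ ^ ((2 * n : ℝ) / ((n : ℝ) - 2)) := by
    rw [eI]
    refine lintegral_congr fun x => ?_
    rw [← ENNReal.ofReal_rpow_of_nonneg (abs_nonneg _) hq0, ← Real.norm_eq_abs,
      ofReal_norm]
  have eJ' : ENNReal.ofReal (∫ x in hsA l r1 r0, ‖fderiv ℝ f x‖ ^ 2)
      = ∫⁻ x in hsA l r1 r0, ‖fderiv ℝ f x‖ₑ ^ (2 : ℝ) := by
    rw [eJ]
    refine lintegral_congr fun x => ?_
    rw [ENNReal.ofReal_pow (norm_nonneg _), ofReal_norm]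
    norm_num
  have hmain := hs_main hn l h1 h10 hf hf0 γ hγ (by rw [← eI']; exact ENNReal.ofReal_ne_top)
  have hI0 : 0 ≤ ∫ x in hsA l r1 r0, |f x| ^ ((2 * n : ℝ) / ((n : ℝ) - 2)) :=
    integral_nonneg fun x => by positivity
  have hJ0 : 0 ≤ ∫ x in hsA l r1 r0, ‖fderiv ℝ f x‖ ^ 2 :=
    integral_nonneg fun x => by positivity
  rw [← eI', ← eJ', ENNReal.ofReal_rpow_of_nonneg hI0 (by positivity),
    show ((γ : ENNReal)) = ENNReal.ofReal (γ : ℝ) by simp, ← ENNReal.ofReal_pow (by positivity),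
    ← ENNReal.ofReal_mul (by positivity), ENNReal.ofReal_le_ofReal_iff (by positivity)] at hmain
  exact hmain
end

section
/- Let 0 < ρ < r0 < 1. For every continuously differentiable function f : ℝ² → ℝ satisfying f(x) = 0 for all x with ‖x‖ = r0, one has ∫_{A(ρ,r0)} f(x)² · (‖x‖ · log(1/‖x‖))^{−2} dx ≤ 4 ∫_{A(ρ,r0)} ‖∇f(x)‖² dx. -/
open MeasureTheory Set

lemma one_dim (ρ r0 : ℝ) (h1 : 0 < ρ) (h2 : ρ < r0) (h3 : r0 < 1) (g g' G : ℝ → ℝ)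
    (hg : ∀ r, HasDerivAt g (g' r) r) (hg' : Continuous g') (hG : Continuous G)
    (hle : ∀ r, |g' r| ≤ G r) (h0 : g r0 = 0) :
    0 ≤ ∫ r in Ioo ρ r0, r * (4 * G r ^ 2 - g r ^ 2 * ((r * Real.log (1 / r)) ^ 2)⁻¹) := by
  have hgc : Continuous g := continuous_iff_continuousAt.2 fun r => (hg r).continuousAt
  have hL : ∀ r ∈ Icc ρ r0, 0 < r ∧ Real.log r < 0 := fun r hr =>
    ⟨by linarith [hr.1], Real.log_neg (by linarith [hr.1]) (by linarith [hr.2])⟩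
  have hlog : ContinuousOn Real.log (Icc ρ r0) :=
    Real.continuousOn_log.mono fun r hr => (hL r hr).1.ne'
  have hder : ∀ r ∈ Icc ρ r0, HasDerivAt (fun r => 2 * g r ^ 2 / Real.log r)
      ((2 * (2 * g r * g' r) * Real.log r - 2 * g r ^ 2 * r⁻¹) / Real.log r ^ 2) r := by
    intro r hr
    have := (((hg r).pow 2).const_mul 2).div (Real.hasDerivAt_log (hL r hr).1.ne') (hL r hr).2.ne
    refine this.congr_deriv ?_
    simp
  have hcont : ContinuousOn (fun r => (2 * (2 * g r * g' r) * Real.log r - 2 * g r ^ 2 * r⁻¹) / Real.log r ^ 2) (Icc ρ r0) := by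
    refine ContinuousOn.div ?_ (hlog.pow 2) fun r hr => pow_ne_zero _ (hL r hr).2.ne
    refine ContinuousOn.sub (ContinuousOn.mul (by fun_prop) hlog) (ContinuousOn.mul (by fun_prop) ?_)
    exact continuousOn_inv₀.mono fun r hr => (hL r hr).1.ne'
  have hftc := intervalIntegral.integral_eq_sub_of_hasDerivAt
    (f := fun r => 2 * g r ^ 2 / Real.log r) (a := ρ) (b := r0)
    (fun r hr => hder r (by rwa [uIcc_of_le h2.le] at hr))
    (ContinuousOn.intervalIntegrable (by rwa [uIcc_of_le h2.le]))
  rw [intervalIntegral.integral_of_le h2.le, integral_Ioc_eq_integral_Ioo] at hftc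
  have hpos : 0 ≤ ∫ r in Ioo ρ r0, (2 * (2 * g r * g' r) * Real.log r - 2 * g r ^ 2 * r⁻¹) / Real.log r ^ 2 := by
    rw [hftc]
    simp only [h0]
    have := (hL ρ ⟨le_rfl, h2.le⟩).2
    have : 2 * g ρ ^ 2 / Real.log ρ ≤ 0 := div_nonpos_of_nonneg_of_nonpos (by positivity) this.le
    simpa using this
  refine hpos.trans ?_
  refine setIntegral_mono_on ?_ ?_ measurableSet_Ioo ?_
  · exact (hcont.integrableOn_compact isCompact_Icc).mono_set Ioo_subset_Icc_self
  · refine (ContinuousOn.integrableOn_compact isCompact_Icc ?_).mono_set Ioo_subset_Icc_self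
    simp only [one_div, Real.log_inv]
    refine continuousOn_id.mul (ContinuousOn.sub (by fun_prop) (ContinuousOn.mul (by fun_prop) ?_))
    refine ContinuousOn.inv₀ ((continuousOn_id.mul hlog.neg).pow 2) fun r hr => ?_
    have := hL r hr
    exact pow_ne_zero _ (mul_ne_zero this.1.ne' (neg_ne_zero.2 this.2.ne))
  · intro r hr
    obtain ⟨hr0, hl⟩ := hL r (Ioo_subset_Icc_self hr)
    have hG2 : g' r ^ 2 ≤ G r ^ 2 := sq_le_sq' (by linarith [(abs_le.1 (hle r)).1]) (abs_le.1 (hle r)).2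
    have : r * (4 * g' r ^ 2 - g r ^ 2 * ((r * Real.log (1 / r)) ^ 2)⁻¹) -
      (2 * (2 * g r * g' r) * Real.log r - 2 * g r ^ 2 * r⁻¹) / Real.log r ^ 2
      = r * (2 * g' r - g r / (r * Real.log r)) ^ 2 := by
      have := hl.ne
      simp only [one_div, Real.log_inv]
      field_simp
      ring
    have h5 : 0 ≤ r * (2 * g' r - g r / (r * Real.log r)) ^ 2 := by positivity
    have h6 : r * g' r ^ 2 ≤ r * G r ^ 2 := by gcongr
    linarith

lemma norm_cs (r θ : ℝ) (hr : 0 ≤ r) : ‖r • !₂[Real.cos θ, Real.sin θ]‖ = r := by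
  rw [norm_smul, EuclideanSpace.norm_eq]
  simp [abs_of_nonneg hr]

lemma polar_euclid (D : EuclideanSpace ℝ (Fin 2) → ℝ) :
    ∫ x, D x = ∫ p in polarCoord.target, p.1 * D (p.1 • !₂[Real.cos p.2, Real.sin p.2]) := by
  have e := (EuclideanSpace.volume_preserving_symm_measurableEquiv_toLp (Fin 2)).symm.integral_comp'
    (g := D)
  have e2 := (volume_preserving_finTwoArrow ℝ).symm.integral_comp'
    (g := fun v => D ((MeasurableEquiv.toLp 2 (Fin 2 → ℝ)).symm.symm v))
  rw [← e, ← e2, ← integral_comp_polarCoord_symm]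
  refine integral_congr_ae (Filter.Eventually.of_forall fun p => ?_)
  simp only [smul_eq_mul]
  congr 2
  ext i
  fin_cases i <;> simp [MeasurableEquiv.finTwoArrow, polarCoord]

lemma polar_annulus (ρ r0 : ℝ) (h1 : 0 < ρ) (D : EuclideanSpace ℝ (Fin 2) → ℝ) :
    ∫ x in {x : EuclideanSpace ℝ (Fin 2) | ρ < ‖x‖ ∧ ‖x‖ < r0}, D x
      = ∫ p in Ioo ρ r0 ×ˢ Ioo (-Real.pi) Real.pi,
          p.1 * D (p.1 • !₂[Real.cos p.2, Real.sin p.2]) := by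
  have hA : MeasurableSet {x : EuclideanSpace ℝ (Fin 2) | ρ < ‖x‖ ∧ ‖x‖ < r0} :=
    (measurableSet_lt measurable_const measurable_norm).inter
      (measurableSet_lt measurable_norm measurable_const)
  rw [← integral_indicator hA, polar_euclid]
  have hS : MeasurableSet (Ioo ρ r0 ×ˢ (univ : Set ℝ)) := measurableSet_Ioo.prod MeasurableSet.univ
  have hset : polarCoord.target ∩ (Ioo ρ r0 ×ˢ (univ : Set ℝ))
      = Ioo ρ r0 ×ˢ Ioo (-Real.pi) Real.pi := by
    rw [polarCoord_target, prod_inter_prod, inter_univ, inter_eq_right.2]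
    exact fun r hr => h1.trans hr.1
  rw [← hset, ← setIntegral_indicator hS]
  refine setIntegral_congr_fun polarCoord.open_target.measurableSet ?_
  intro p hp
  have hp0 : 0 < p.1 := hp.1
  have hn := norm_cs p.1 p.2 hp0.le
  by_cases h : ρ < p.1 ∧ p.1 < r0
  · have h' : p.1 • !₂[Real.cos p.2, Real.sin p.2] ∈
        {x : EuclideanSpace ℝ (Fin 2) | ρ < ‖x‖ ∧ ‖x‖ < r0} := by
      change _ < ‖_‖ ∧ ‖_‖ < _
      rwa [hn]
    have h'' : p ∈ Ioo ρ r0 ×ˢ (univ : Set ℝ) := ⟨h, trivial⟩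
    simp only [indicator_of_mem h', indicator_of_mem h'']
  · have h' : p.1 • !₂[Real.cos p.2, Real.sin p.2] ∉
        {x : EuclideanSpace ℝ (Fin 2) | ρ < ‖x‖ ∧ ‖x‖ < r0} := by
      change ¬ (_ < ‖_‖ ∧ ‖_‖ < _)
      rwa [hn]
    have h'' : p ∉ Ioo ρ r0 ×ˢ (univ : Set ℝ) := fun hh => h hh.1
    simp only [indicator_of_notMem h', indicator_of_notMem h'', mul_zero]




/-- Weighted (hyperbolic) Poincaré inequality with constant `4` on a planar annulus,
for functions vanishing on the outer boundary (proof of Lemma 4.2, case `n = 2`). -/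
theorem annulus_hyperbolic_poincare (ρ r0 : ℝ) (h1 : 0 < ρ) (h2 : ρ < r0) (h3 : r0 < 1)
    (f : EuclideanSpace ℝ (Fin 2) → ℝ) (hf : ContDiff ℝ 1 f)
    (hb : ∀ x : EuclideanSpace ℝ (Fin 2), ‖x‖ = r0 → f x = 0) :
    ∫ x in {x : EuclideanSpace ℝ (Fin 2) | ρ < ‖x‖ ∧ ‖x‖ < r0},
        (f x) ^ 2 * ((‖x‖ * Real.log (1 / ‖x‖)) ^ 2)⁻¹
      ≤ 4 * ∫ x in {x : EuclideanSpace ℝ (Fin 2) | ρ < ‖x‖ ∧ ‖x‖ < r0},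
          ‖fderiv ℝ f x‖ ^ 2 := by
  set A := {x : EuclideanSpace ℝ (Fin 2) | ρ < ‖x‖ ∧ ‖x‖ < r0} with hAdef
  have hfc : Continuous f := hf.continuous
  have hdc : Continuous (fderiv ℝ f) := hf.continuous_fderiv (by norm_num)
  let K : Set (EuclideanSpace ℝ (Fin 2)) := Metric.closedBall 0 r0 ∩ {x | ρ ≤ ‖x‖}
  have hK : IsCompact K := (isCompact_closedBall _ _).inter_right
    (isClosed_le continuous_const continuous_norm)
  have hKn : ∀ x ∈ K, 0 < ‖x‖ ∧ Real.log ‖x‖ < 0 := by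
    intro x hx
    have ha : ‖x‖ ≤ r0 := by simpa using hx.1
    have hb' : ρ ≤ ‖x‖ := hx.2
    exact ⟨by linarith, Real.log_neg (by linarith) (by linarith)⟩
  have hAK : A ⊆ K := fun x hx => ⟨by simpa using hx.2.le, hx.1.le⟩
  have c1 : ContinuousOn (fun x => (f x) ^ 2 * ((‖x‖ * Real.log (1 / ‖x‖)) ^ 2)⁻¹) K := by
    simp only [one_div, Real.log_inv]
    refine ContinuousOn.mul (by fun_prop) (ContinuousOn.inv₀ ?_ ?_)
    · refine ContinuousOn.pow (ContinuousOn.mul (by fun_prop) (ContinuousOn.neg ?_)) 2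
      exact ContinuousOn.log (by fun_prop) fun x hx => (hKn x hx).1.ne'
    · intro x hx
      have := hKn x hx
      exact pow_ne_zero _ (mul_ne_zero this.1.ne' (neg_ne_zero.2 this.2.ne))
  have c2 : ContinuousOn (fun x => 4 * ‖fderiv ℝ f x‖ ^ 2) K := by fun_prop
  have i1 := (c1.integrableOn_compact (μ := volume) hK).mono_set hAK
  have i2 := (c2.integrableOn_compact (μ := volume) hK).mono_set hAK
  rw [← integral_const_mul, ← sub_nonneg, ← integral_sub i2 i1, hAdef, polar_annulus ρ r0 h1]
  have he : Continuous fun p : ℝ × ℝ => p.1 • !₂[Real.cos p.2, Real.sin p.2] := by fun_prop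
  have hint : IntegrableOn (fun p : ℝ × ℝ => p.1 *
      (4 * ‖fderiv ℝ f (p.1 • !₂[Real.cos p.2, Real.sin p.2])‖ ^ 2 -
        f (p.1 • !₂[Real.cos p.2, Real.sin p.2]) ^ 2 *
        ((‖p.1 • !₂[Real.cos p.2, Real.sin p.2]‖ *
          Real.log (1 / ‖p.1 • !₂[Real.cos p.2, Real.sin p.2]‖)) ^ 2)⁻¹))
      (Ioo ρ r0 ×ˢ Ioo (-Real.pi) Real.pi) volume := by
    refine (ContinuousOn.integrableOn_compact (K := Icc ρ r0 ×ˢ Icc (-Real.pi) Real.pi)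
      (isCompact_Icc.prod isCompact_Icc) ?_).mono_set
      (prod_mono Ioo_subset_Icc_self Ioo_subset_Icc_self)
    refine continuousOn_fst.mul ?_
    refine (c2.sub c1).comp he.continuousOn ?_
    intro p hp
    have hn := norm_cs p.1 p.2 (h1.le.trans hp.1.1)
    refine ⟨?_, ?_⟩
    · rw [mem_closedBall_zero_iff, hn]; exact hp.1.2
    · change _ ≤ ‖_‖
      rw [hn]; exact hp.1.1
  rw [IntegrableOn, Measure.volume_eq_prod, ← Measure.prod_restrict] at hint
  rw [Measure.volume_eq_prod, ← Measure.prod_restrict, integral_prod_symm _ hint]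
  refine integral_nonneg fun θ => ?_
  set e : EuclideanSpace ℝ (Fin 2) := !₂[Real.cos θ, Real.sin θ] with hedef
  have hen : ‖e‖ = 1 := by simpa using norm_cs 1 θ zero_le_one
  have key := one_dim ρ r0 h1 h2 h3 (fun r => f (r • e)) (fun r => fderiv ℝ f (r • e) e)
    (fun r => ‖fderiv ℝ f (r • e)‖) ?_ (by fun_prop) (by fun_prop) ?_ ?_
  · refine key.trans_eq (setIntegral_congr_fun measurableSet_Ioo fun r hr => ?_)
    have hn := norm_cs r θ (h1.le.trans hr.1.le)
    simp only [← hedef] at hn ⊢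
    rw [hn]
  · intro r
    have hd := (hf.differentiable (by norm_num) (r • e)).hasFDerivAt
    have hl : HasDerivAt (fun r : ℝ => r • e) e r := by
      simpa using (hasDerivAt_id r).smul_const e
    exact hd.comp_hasDerivAt r hl
  · intro r
    have := (fderiv ℝ f (r • e)).le_opNorm e
    rwa [hen, mul_one, Real.norm_eq_abs] at this
  · exact hb _ (norm_cs r0 θ (h1.trans h2).le)
end

section
/- For every real number t with 0 < t < (1/2)·log(2 + √3), one has t · cosh(t) < 1.2 · sinh(t) (equivalently, coth t < 1.2/t). -/
/-- For `0 < t < (1/2) log(2 + √3)` one has `coth t < 1.2 / t`, i.e.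
`t cosh t < 1.2 sinh t` (proof of Theorem 5.3 of the paper). -/
theorem coth_lt_of_lt_T21 (t : ℝ) (ht : 0 < t)
    (ht' : t < (1 / 2) * Real.log (2 + Real.sqrt 3)) :
    t * Real.cosh t < 1.2 * Real.sinh t := by
  have h3 : Real.sqrt 3 < 1.733 := by
    rw [Real.sqrt_lt' (by norm_num)]; norm_num
  have hlog : Real.log (2 + Real.sqrt 3) < 1.326 := by
    rw [Real.log_lt_iff_lt_exp (by positivity)]
    have h1 := Real.exp_one_gt_d9
    have h2 := Real.quadratic_le_exp_of_nonneg (x := 0.326) (by norm_num)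
    have h4 : Real.exp 1.326 = Real.exp 1 * Real.exp 0.326 := by
      rw [← Real.exp_add]; norm_num
    rw [h4]
    norm_num at h1 h2 ⊢
    nlinarith
  have htb : t < 0.663 := by linarith
  have hs : t ^ 2 < 0.44 := by nlinarith
  have hsinh : t + t ^ 3 / 6 ≤ Real.sinh t := by
    have h := sum_le_hasSum (Finset.range 2) (fun i _ => by positivity) (Real.hasSum_sinh t)
    norm_num [Finset.sum_range_succ, Nat.factorial] at h
    exact h
  have hc : Real.cosh t * (1 - t ^ 2 / 2) ≤ 1 := by
    have h1 := Real.cosh_le_exp_half_sq t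
    have h2 := Real.add_one_le_exp (-(t ^ 2 / 2))
    have h3 : Real.exp (t ^ 2 / 2) * Real.exp (-(t ^ 2 / 2)) = 1 := by
      rw [← Real.exp_add]; simp
    calc Real.cosh t * (1 - t ^ 2 / 2) ≤ Real.exp (t ^ 2 / 2) * Real.exp (-(t ^ 2 / 2)) :=
          mul_le_mul h1 (by linarith) (by linarith) (Real.exp_pos _).le
      _ = 1 := h3
  have hc2 : Real.cosh t < 1.2 + 0.2 * t ^ 2 := by
    have h5 : 1 < (1.2 + 0.2 * t ^ 2) * (1 - t ^ 2 / 2) := by nlinarith [sq_nonneg t]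
    exact lt_of_mul_lt_mul_right (lt_of_le_of_lt hc h5) (by linarith)
  have := mul_lt_mul_of_pos_left hc2 ht
  nlinarith
end

section
/- For every real number k > 2, the unique positive solution T of k · tanh(k·T) = coth T satisfies T < (1/2)·log(2 + √3). -/
/-- For `k > 2`, the positive solution `T = T_{k,1}` of `k tanh(kT) = coth T`
satisfies `T < (1/2) log(2 + √3) = T_{2,1}` (Fan–Tam–Yu, Lemma 2.3; used in
the proof of Theorem 5.3 of the paper). -/
theorem Tk1_lt_T21 (k T : ℝ) (hk : 2 < k) (hT : 0 < T)
    (h : k * Real.tanh (k * T) = Real.cosh T / Real.sinh T) :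
    T < (1 / 2) * Real.log (2 + Real.sqrt 3) := by
  have hs : 0 < Real.sinh T := Real.sinh_pos_iff.2 hT
  have hc : 0 < Real.cosh T := Real.cosh_pos T
  have hS : 0 < Real.sinh (k * T) := Real.sinh_pos_iff.2 (by positivity)
  have hC : 0 < Real.cosh (k * T) := Real.cosh_pos _
  have hd : 0 < Real.sinh (k * T - 2 * T) := Real.sinh_pos_iff.2 (by nlinarith)
  rw [Real.sinh_sub, Real.sinh_two_mul] at hd
  rw [Real.tanh_eq_sinh_div_cosh] at h
  have hC2 : 0 < Real.cosh (2 * T) := Real.cosh_pos _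
  have hcs := Real.cosh_sq T
  have hC2e := Real.cosh_two_mul T
  have hx : Real.cosh (2 * T) = (Real.exp (2 * T) + Real.exp (-(2 * T))) / 2 := Real.cosh_eq _
  have hee : Real.exp (2 * T) * Real.exp (-(2 * T)) = 1 := by
    rw [← Real.exp_add]; simp
  have hep := Real.exp_pos (2 * T)
  field_simp at h
  generalize Real.cosh (2 * T) = D at *
  generalize Real.sinh (k * T) = S at *
  generalize Real.cosh (k * T) = C at *
  have h1 : 2 * (S * Real.sinh T) < Real.cosh T * C := by
    have : k * (S * Real.sinh T) = Real.cosh T * C := by linarith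
    have h0 : 0 < S * Real.sinh T := by positivity
    nlinarith
  have h2 : (4 * Real.sinh T ^ 2) * (Real.cosh T * C) < D * (Real.cosh T * C) := by
    have a := mul_lt_mul_of_pos_right h1 hC2
    have b := mul_pos hs hd
    nlinarith
  have h3 : 4 * Real.sinh T ^ 2 < D := lt_of_mul_lt_mul_right h2 (by positivity)
  have h4 : D < 2 := by linarith
  have h5 : Real.exp (2 * T) < 2 + Real.sqrt 3 := by
    have h6 : (Real.exp (2 * T) - 2) ^ 2 < 3 := by nlinarith
    have := Real.lt_sqrt_of_sq_lt h6
    linarith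
  have := (Real.lt_log_iff_exp_lt (by positivity)).2 h5
  linarith
end

section
/- Let l ≥ 2 be an integer and let T > 0 be a real number satisfying 2l · tanh(2l·T) = coth T. Then 2l · tanh(2l·T) < 2l + √3 − 2. -/
/-- For an integer `l ≥ 2` and `T = T_{2l,1}` the positive solution of
`2l tanh(2lT) = coth T`, one has `2l tanh(2lT) < 2l + √3 − 2` (the key estimate
in the proof of Theorem 5.3 of the paper). -/
theorem mobius_eigenvalue_estimate (l : ℕ) (hl : 2 ≤ l) (T : ℝ) (hT : 0 < T)
    (h : (2 * l : ℝ) * Real.tanh (2 * l * T) = Real.cosh T / Real.sinh T) :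
    (2 * l : ℝ) * Real.tanh (2 * l * T) < 2 * l + Real.sqrt 3 - 2 := by
  have hl' : (2 : ℝ) ≤ l := by exact_mod_cast hl
  generalize hn : (2 * l : ℝ) = n at *
  have hn4 : 4 ≤ n := by linarith
  have hs3 : (1.73 : ℝ) < Real.sqrt 3 := Real.lt_sqrt_of_sq_lt (by norm_num)
  by_contra hc
  push Not at hc
  have hs : 0 < Real.sinh T := Real.sinh_pos_iff.2 hT
  have h1 : Real.cosh T / Real.sinh T ≤ 1 + 1 / T := by
    rw [div_le_iff₀ hs]
    have h2 : T * Real.exp (-T) ≤ Real.sinh T := by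
      have e1 : 2 * T + 1 ≤ Real.exp (2 * T) := Real.add_one_le_exp _
      have e2 : Real.exp (2 * T) * Real.exp (-T) = Real.exp T := by
        rw [← Real.exp_add]; ring_nf
      rw [Real.sinh_eq]
      nlinarith [Real.exp_pos (-T)]
    have h3 : Real.cosh T - Real.sinh T = Real.exp (-T) := Real.cosh_sub_sinh T
    have h4 : Real.exp (-T) ≤ Real.sinh T / T := by
      rw [le_div_iff₀ hT]; linarith
    have : (1 + 1 / T) * Real.sinh T = Real.sinh T + Real.sinh T / T := by ring
    linarith
  have h5 : n - 1.27 ≤ 1 / T := by linarith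
  have h6 : (n - 1.27) * T ≤ 1 := by rwa [le_div_iff₀ hT] at h5
  have h7 : n * T ≤ 3 / 2 := by nlinarith
  have h8 : Real.exp (2 * (n * T)) ≤ 21 := by
    have : Real.exp (2 * (n * T)) ≤ Real.exp 3 := Real.exp_le_exp.2 (by linarith)
    have e3 : Real.exp 3 = Real.exp 1 ^ 3 := by rw [← Real.exp_nat_mul]; norm_num
    have e4 : Real.exp 1 ^ 3 ≤ 2.7182818286 ^ 3 :=
      pow_le_pow_left₀ (Real.exp_pos 1).le Real.exp_one_lt_d9.le 3
    norm_num at e4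
    linarith
  have h9 : Real.tanh (n * T) ≤ 10 / 11 := by
    rw [Real.tanh_eq_sinh_div_cosh, div_le_iff₀ (Real.cosh_pos _), Real.sinh_eq, Real.cosh_eq]
    have e2 : Real.exp (2 * (n * T)) * Real.exp (-(n * T)) = Real.exp (n * T) := by
      rw [← Real.exp_add]; ring_nf
    nlinarith [Real.exp_pos (-(n * T))]
  nlinarith
end
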